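/- arXiv:1503.06444 — 3 statements merged into one kernel-verified Lean document; each statement's English description precedes it below -/
import Mathlib

section
/- Let K be a field of characteristic different from 2, let m and r be nonnegative integers with m ≥ 2(r+1), and let q be a nondegenerate quadratic form on K^m. Then q vanishes identically on some (r+1)-dimensional K-linear subspace of K^m if and only if there exists a quadratic form q' on K^{m-2(r+1)} such that q is equivalent (isometric) to the orthogonal sum of r+1 copies of the hyperbolic plane H = <1, -1> and q'. -/
theorem aux_sum_zero {K : Type*} [Field K] (g : ℕ → K) (n : ℕ) :
    ∑ k ∈ Finset.range (2 * n), (-1 : K) ^ k * g (k / 2) = 0 := by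
  induction n with
  | zero => simp
  | succ n ih =>
    have h1 : (2 * n + 1) / 2 = n := by omega
    have h2 : (2 * n) / 2 = n := by omega
    rw [show 2 * (n + 1) = 2 * n + 1 + 1 by ring, Finset.sum_range_succ, Finset.sum_range_succ, ih,
      h1, h2, pow_succ, pow_mul]
    simp

theorem aux_backward {K : Type*} [Field K] (m n p : ℕ) (q : QuadraticForm K (Fin m → K))
    (q' : QuadraticForm K (Fin p → K))
    (h : QuadraticMap.Equivalent q ((QuadraticMap.weightedSumSquares K
            (fun i : Fin (2 * n) => (-1 : K) ^ (i : ℕ))).prod q')) :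
    ∃ W : Submodule K (Fin m → K), Module.finrank K ↥W = n ∧ ∀ x ∈ W, q x = 0 := by
  obtain ⟨e⟩ := h
  let half : Fin (2 * n) → Fin n := fun k => ⟨k / 2, by omega⟩
  let f : (Fin n → K) →ₗ[K] (Fin (2 * n) → K) := LinearMap.funLeft K K half
  have hhalf : Function.Surjective half := fun j => ⟨⟨2 * j, by omega⟩, by ext; simp [half]⟩
  have hf : Function.Injective f := LinearMap.funLeft_injective_of_surjective K K half hhalf
  let g : (Fin n → K) →ₗ[K] (Fin m → K) :=
    e.toLinearEquiv.symm.toLinearMap ∘ₗ (LinearMap.inl K _ _) ∘ₗ f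
  have hg : Function.Injective g :=
    e.toLinearEquiv.symm.injective.comp (LinearMap.inl_injective.comp hf)
  refine ⟨LinearMap.range g, ?_, ?_⟩
  · rw [LinearMap.finrank_range_of_inj hg]; simp
  · rintro _ ⟨x, rfl⟩
    have h1 := e.map_app (g x)
    have h2 : e (g x) = (f x, 0) := e.toLinearEquiv.apply_symm_apply _
    rw [← h1, h2]
    simp only [QuadraticMap.prod_apply, QuadraticMap.weightedSumSquares_apply, map_zero, add_zero]
    let G : ℕ → K := fun j => if hj : j < n then x ⟨j, hj⟩ * x ⟨j, hj⟩ else 0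
    rw [← aux_sum_zero G n, Finset.sum_range]
    refine Finset.sum_congr rfl fun k _ => ?_
    have hk : (k : ℕ) / 2 < n := by omega
    simp [G, hk, f, half, LinearMap.funLeft_apply]

theorem aux_two {K : Type*} [Field K] {V : Type*} [AddCommGroup V] [Module K V]
    (q : QuadraticForm K V) (x : V) : q.polarBilin x x = 2 * q x := by
  simp [QuadraticMap.polar_self]

/-- Hyperbolic frame. -/
theorem aux_frame {K : Type*} [Field K] (h2 : (2 : K) ≠ 0) {V : Type*} [AddCommGroup V]
    [Module K V] [FiniteDimensional K V] (q : QuadraticForm K V)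
    (hq : LinearMap.BilinForm.Nondegenerate q.polarBilin) (n : ℕ)
    (W : Submodule K V) (hW : Module.finrank K W = n) (h0 : ∀ x ∈ W, q x = 0) :
    ∃ w v : Fin n → V, (∀ i j, q.polarBilin (w i) (w j) = 0) ∧
      (∀ i j, q.polarBilin (v i) (v j) = 0) ∧
      (∀ i j, q.polarBilin (w i) (v j) = if i = j then 1 else 0) := by
  have hs : ∀ x y, q.polarBilin x y = q.polarBilin y x := fun x y => by
    simp [QuadraticMap.polar_comm]
  let b := Module.finBasisOfFinrankEq K W hW
  have hww : ∀ i j, q.polarBilin (b i : V) (b j : V) = 0 := fun i j => by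
    simp only [QuadraticMap.polarBilin_apply_apply, QuadraticMap.polar]
    rw [h0 _ (b i).2, h0 _ (b j).2, h0 _ (W.add_mem (b i).2 (b j).2)]; simp
  have hu : ∀ j, ∃ u : V, ∀ i, q.polarBilin (b i : V) u = if i = j then 1 else 0 := fun j => by
    obtain ⟨f, hf⟩ := LinearMap.exists_extend (b.coord j)
    refine ⟨(LinearMap.BilinForm.toDual q.polarBilin hq).symm f, fun i => ?_⟩
    rw [hs, LinearMap.BilinForm.apply_toDual_symm_apply]
    have := LinearMap.congr_fun hf (b i)
    simp only [LinearMap.comp_apply, Submodule.subtype_apply] at this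
    rw [this]
    simp [Finsupp.single_apply]
  choose u hu using hu
  have hu' : ∀ j i, q.polarBilin (u j) (b i : V) = if i = j then 1 else 0 := fun j i => by
    rw [hs, hu]
  refine ⟨fun i => b i, fun j => u j - (2 : K)⁻¹ • ∑ i, q.polarBilin (u i) (u j) • (b i : V),
    hww, fun i j => ?_, fun i j => ?_⟩
  · simp only [map_sub, map_smul, map_sum, LinearMap.sub_apply, LinearMap.smul_apply,
      LinearMap.sum_apply, hww, hu, hu', smul_eq_mul, mul_ite, mul_one, mul_zero,
      Finset.sum_ite_eq', Finset.sum_ite_eq, Finset.sum_const_zero, Finset.mem_univ, if_true]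
    rw [hs (u j) (u i)]
    field_simp
    ring_nf
    simp
  · simp only [map_sub, map_smul, map_sum, hww, hu, smul_eq_mul, mul_zero,
      Finset.sum_const_zero, sub_zero]

theorem aux_forward {K : Type*} [Field K] (h2 : (2 : K) ≠ 0) (m n : ℕ) (hm : 2 * n ≤ m)
    (q : QuadraticForm K (Fin m → K))
    (hq : LinearMap.BilinForm.Nondegenerate q.polarBilin)
    (W : Submodule K (Fin m → K)) (hW : Module.finrank K W = n) (h0 : ∀ x ∈ W, q x = 0) :
    ∃ q' : QuadraticForm K (Fin (m - 2 * n) → K),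
        QuadraticMap.Equivalent q
          ((QuadraticMap.weightedSumSquares K
            (fun i : Fin (2 * n) => (-1 : K) ^ (i : ℕ))).prod q') := by
  obtain ⟨w, v, hww, hvv, hwv⟩ := aux_frame h2 q hq n W hW h0
  have hs : ∀ x y, q.polarBilin x y = q.polarBilin y x := fun x y => by
    simp [QuadraticMap.polar_comm]
  have hvw : ∀ i j, q.polarBilin (v i) (w j) = if i = j then 1 else 0 := fun i j => by
    rw [hs, hwv]; simp [eq_comm]
  let half : Fin (2 * n) → Fin n := fun k => ⟨k / 2, by omega⟩
  let e : Fin (2 * n) → (Fin m → K) := fun k => w (half k) + (-1 : K) ^ (k : ℕ) • v (half k)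
  have he : ∀ k l, q.polarBilin (e k) (e l) = if k = l then 2 * (-1 : K) ^ (k : ℕ) else 0 := by
    intro k l
    simp only [e, map_add, map_smul, LinearMap.add_apply, LinearMap.smul_apply, hww, hvv, hwv, hvw,
      smul_eq_mul, mul_zero, zero_add, add_zero]
    by_cases hkl : k = l
    · subst hkl; simp; ring
    · rw [if_neg hkl]
      by_cases hh : half k = half l
      · simp only [hh, if_true, mul_one]
        have h3 : (k : ℕ) / 2 = (l : ℕ) / 2 := congrArg Fin.val hh
        have h4 : (k : ℕ) ≠ l := fun h => hkl (Fin.ext h)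
        rcases Nat.even_or_odd (k : ℕ) with hk | hk
        · have hl : Odd (l : ℕ) := by
            rw [Nat.even_iff] at hk; rw [Nat.odd_iff]; omega
          simp [hk.neg_one_pow, hl.neg_one_pow]
        · have hl : Even (l : ℕ) := by
            rw [Nat.odd_iff] at hk; rw [Nat.even_iff]; omega
          simp [hk.neg_one_pow, hl.neg_one_pow]
      · simp [hh]
  let φ : (Fin (2 * n) → K) →ₗ[K] (Fin m → K) := Fintype.linearCombination K e
  have hφ : ∀ x, φ x = ∑ k, x k • e k := fun x => Fintype.linearCombination_apply K e x
  have hφe : ∀ x l, q.polarBilin (φ x) (e l) = 2 * (-1 : K) ^ (l : ℕ) * x l := by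
    intro x l
    simp only [hφ, map_sum, map_smul, LinearMap.sum_apply, LinearMap.smul_apply, he, smul_eq_mul,
      mul_ite, mul_zero, Finset.sum_ite_eq', Finset.mem_univ, if_true]
    ring
  have hqφ : ∀ x, q (φ x) = ∑ l : Fin (2 * n), (-1 : K) ^ (l : ℕ) * (x l * x l) := by
    intro x
    apply mul_left_cancel₀ h2
    rw [← aux_two]
    conv_lhs => rw [hφ x, map_sum]
    rw [← hφ x, Finset.mul_sum]
    refine Finset.sum_congr rfl fun l _ => ?_
    rw [map_smul, hφe, smul_eq_mul]; ring
  have hne : ∀ l : ℕ, 2 * (-1 : K) ^ l ≠ 0 := fun l =>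
    mul_ne_zero h2 (pow_ne_zero _ (neg_ne_zero.mpr one_ne_zero))
  have hφinj : Function.Injective φ := by
    rw [injective_iff_map_eq_zero]
    intro x hx
    ext l
    have := hφe x l
    rw [hx, map_zero, LinearMap.zero_apply] at this
    exact (mul_eq_zero.mp this.symm).resolve_left (hne l)
  let U := LinearMap.range φ
  let P := LinearMap.BilinForm.orthogonal q.polarBilin U
  have heU : ∀ l, e l ∈ U := fun l => ⟨Pi.single l 1, by simp [φ]⟩
  have hP : Module.finrank K P = m - 2 * n := by
    have := LinearMap.BilinForm.finrank_orthogonal hq U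
    rw [this, LinearMap.finrank_range_of_inj hφinj]; simp
  let c : (Fin (m - 2 * n) → K) ≃ₗ[K] P :=
    (Module.finBasisOfFinrankEq K P hP).equivFun.symm
  let ι : (Fin (m - 2 * n) → K) →ₗ[K] (Fin m → K) := P.subtype ∘ₗ c.toLinearMap
  have hιinj : Function.Injective ι := Subtype.val_injective.comp c.injective
  have hort : ∀ x y, q.polarBilin (φ x) (ι y) = 0 := fun x y =>
    (LinearMap.BilinForm.mem_orthogonal_iff.mp (c y).2) (φ x) ⟨x, rfl⟩
  let Ψ := φ.coprod ι
  have hΨ : Function.Injective Ψ := by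
    rw [injective_iff_map_eq_zero]
    rintro ⟨x, y⟩ hxy
    simp only [Ψ, LinearMap.coprod_apply] at hxy
    have hx : x = 0 := by
      ext l
      have h5 := hφe x l
      obtain ⟨z, hz⟩ := heU l
      have h6 : q.polarBilin (φ x + ι y) (e l) = 0 := by rw [hxy]; simp
      rw [map_add q.polarBilin, LinearMap.add_apply, h5, ← hz, hs (ι y), hort, add_zero] at h6
      exact (mul_eq_zero.mp h6).resolve_left (hne l)
    subst hx
    rw [map_zero, zero_add] at hxy
    have hy : y = 0 := hιinj (by rw [hxy, map_zero])
    rw [hy]; rfl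
  let E := LinearEquiv.ofInjectiveOfFinrankEq Ψ hΨ (by simp; omega)
  refine ⟨q.comp ι, ⟨QuadraticMap.IsometryEquiv.symm ⟨E, ?_⟩⟩⟩
  rintro ⟨x, y⟩
  have hE : E (x, y) = φ x + ι y := rfl
  have h7 := hort x y
  rw [QuadraticMap.polarBilin_apply_apply, QuadraticMap.polar] at h7
  change q (E (x, y)) = _
  rw [hE, QuadraticMap.prod_apply, QuadraticMap.weightedSumSquares_apply, QuadraticMap.comp_apply]
  simp only [smul_eq_mul]
  rw [← hqφ]
  linear_combination h7


/-- A nondegenerate quadratic form on `K^m` (char `K ≠ 2`, `m ≥ 2(r+1)`) vanishes identically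
on some `(r+1)`-dimensional linear subspace iff it is equivalent to the orthogonal sum of
`r+1` hyperbolic planes `⟨1, -1⟩` and some quadratic form `q'` on `K^{m - 2(r+1)}`. -/
theorem vanishing_subspace_iff_split_hyperbolic (K : Type*) [Field K] (hchar : ringChar K ≠ 2)
    (m r : ℕ) (hm : 2 * (r + 1) ≤ m) (q : QuadraticForm K (Fin m → K))
    (hq : LinearMap.BilinForm.Nondegenerate q.polarBilin) :
    (∃ W : Submodule K (Fin m → K), Module.finrank K ↥W = r + 1 ∧ ∀ x ∈ W, q x = 0) ↔
      ∃ q' : QuadraticForm K (Fin (m - 2 * (r + 1)) → K),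
        QuadraticMap.Equivalent q
          ((QuadraticMap.weightedSumSquares K
            (fun i : Fin (2 * (r + 1)) => (-1 : K) ^ (i : ℕ))).prod q') := by
  have h2 : (2 : K) ≠ 0 := Ring.two_ne_zero hchar
  constructor
  · rintro ⟨W, hW, h0⟩
    exact aux_forward h2 m (r + 1) hm q hq W hW h0
  · rintro ⟨q', h⟩
    exact aux_backward m (r + 1) _ q q' h
end

section
/- Let F be a field of characteristic 0 and let r ≥ 0 be an integer. Let f and g be quadratic forms on F^{2r+3} such that the quadratic form f + t·g on F(t)^{2r+3} over the rational function field F(t) is nondegenerate, and let δ(t) ∈ F(t)^× be the determinant of its Gram matrix with respect to the standard basis. Then there exists an (r+1)-dimensional F-linear subspace of F^{2r+3} on which both f and g vanish identically if and only if the quadratic form f + t·g over F(t) is equivalent to the orthogonal sum of r+1 copies of the hyperbolic plane H = <1, -1> and the one-dimensional form <(-1)^{r+1} δ(t)>. -/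
/-- The base change of a quadratic form on `K^m` along a field homomorphism `σ : K →+* L`,
obtained by applying `σ` entrywise to the Gram matrix of the form. -/
noncomputable def QuadraticForm.mapBase {K L : Type*} [Field K] [Field L] [Invertible (2 : K)]
    {m : ℕ} (σ : K →+* L) (q : QuadraticForm K (Fin m → K)) :
    QuadraticForm L (Fin m → L) :=
  ((QuadraticMap.toMatrix' q).map σ).toQuadraticMap'

section AmerPart
open Polynomial

theorem amer_good_update {R V : Type*} [CommRing R] [IsDomain R] [AddCommGroup V] [Module R V]
    {m : ℕ}
    (β : LinearMap.BilinForm R V) (hβ : ∀ x y, β x y = β y x) (w : Fin m → V)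
    (hli : LinearIndependent R w) (h0 : ∀ i j, β (w i) (w j) = 0)
    (i : Fin m) (v : V) (s : R) (hs : s ≠ 0) (c : Fin m → R) (hc : c i ≠ 0)
    (hv : s • v = ∑ j, c j • w j) :
    LinearIndependent R (Function.update w i v) ∧
      ∀ j k, β (Function.update w i v j) (Function.update w i v k) = 0 := by
  classical
  constructor
  · rw [Fintype.linearIndependent_iff] at hli ⊢
    intro a ha
    have hsplit : a i • v + ∑ j, (if j = i then 0 else a j) • w j = 0 := by
      rw [← ha, ← Finset.add_sum_erase _ _ (Finset.mem_univ i),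
        ← Finset.add_sum_erase (a := i) Finset.univ (fun j => a j • Function.update w i v j)
          (Finset.mem_univ i)]
      simp only [Function.update_self, if_true, zero_smul, zero_add]
      congr 1
      refine Finset.sum_congr rfl fun j hj => ?_
      have hji : j ≠ i := Finset.ne_of_mem_erase hj
      simp [hji]
    have h2 : ∑ j, (a i * c j + s * (if j = i then 0 else a j)) • w j = 0 := by
      have : s • (a i • v + ∑ j, (if j = i then 0 else a j) • w j) = 0 := by
        rw [hsplit, smul_zero]
      rw [smul_add, smul_comm, hv, Finset.smul_sum, Finset.smul_sum, ← Finset.sum_add_distrib] at this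
      rw [← this]
      refine Finset.sum_congr rfl fun j _ => ?_
      rw [add_smul, mul_smul, mul_smul]
    have h3 := hli _ h2
    have hi : a i = 0 := by
      have := h3 i
      simpa [hc] using this
    intro j
    by_cases hj : j = i
    · rw [hj, hi]
    · have := h3 j
      simpa [hi, hj, hs] using this
  · have hvw : ∀ k, β v (w k) = 0 := by
      intro k
      have : s * β v (w k) = 0 := by
        rw [← smul_eq_mul, ← LinearMap.smul_apply, ← map_smul, hv]
        simp [h0]
      simpa [hs] using this
    have hvv : β v v = 0 := by
      have : s * β v v = 0 := by
        rw [← smul_eq_mul, ← map_smul, hv]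
        simp [hvw]
      simpa [hs] using this
    intro j k
    by_cases hj : j = i <;> by_cases hk : k = i
    · subst hj; subst hk; simpa using hvv
    · subst hj; simp [hk, hvw]
    · subst hk; rw [hβ]; simp [hj, hvw]
    · simp [hj, hk, h0]

/-- The polynomial pencil as a bilinear form. -/
noncomputable def amerPencil {F : Type*} [Field F] {n : ℕ} (A B : Matrix (Fin n) (Fin n) F) :
    LinearMap.BilinForm F[X] (Fin n → F[X]) :=
  Matrix.toBilin' (A.map C + (X : F[X]) • B.map C)

section
variable {F : Type*} [Field F] {n : ℕ} (A B : Matrix (Fin n) (Fin n) F)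

theorem amerPencil_apply (x y : Fin n → F[X]) :
    amerPencil A B x y = ∑ i, ∑ j, x i * (C (A i j) + X * C (B i j)) * y j := by
  simp only [amerPencil, Matrix.toBilin'_apply, Matrix.add_apply, Matrix.map_apply,
    Matrix.smul_apply, smul_eq_mul]

theorem amerPencil_symm (hA : A.IsSymm) (hB : B.IsSymm) (x y : Fin n → F[X]) :
    amerPencil A B x y = amerPencil A B y x := by
  rw [amerPencil_apply, amerPencil_apply, Finset.sum_comm]
  refine Finset.sum_congr rfl fun i _ => Finset.sum_congr rfl fun j _ => ?_
  rw [hA.apply, hB.apply]; ring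

theorem amerPencil_eval (x y : Fin n → F[X]) :
    (amerPencil A B x y).eval 0 =
      Matrix.toBilin' A (fun i => (x i).eval 0) (fun i => (y i).eval 0) := by
  rw [amerPencil_apply, Matrix.toBilin'_apply]
  simp [eval_finsetSum]

theorem amerPencil_C (u v : Fin n → F) :
    amerPencil A B (fun i => C (u i)) (fun i => C (v i)) =
      C (Matrix.toBilin' A u v) + X * C (Matrix.toBilin' B u v) := by
  rw [amerPencil_apply, Matrix.toBilin'_apply, Matrix.toBilin'_apply]
  simp only [map_sum, Finset.mul_sum, ← Finset.sum_add_distrib, map_mul]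
  refine Finset.sum_congr rfl fun i _ => Finset.sum_congr rfl fun j _ => ?_
  ring

theorem amerPencil_natDegree (x : Fin n → F[X]) (u : Fin n → F) (d : ℕ)
    (hx : ∀ k, (x k).natDegree ≤ d) :
    (amerPencil A B x (fun i => C (u i))).natDegree ≤ d + 1 := by
  rw [amerPencil_apply]
  refine natDegree_sum_le_of_forall_le _ _ fun i _ => natDegree_sum_le_of_forall_le _ _ fun j _ => ?_
  refine (natDegree_mul_C_le _ _).trans ?_
  refine natDegree_mul_le_of_le (hx i) ?_
  refine natDegree_add_le_of_degree_le (by simp) ?_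
  exact (natDegree_mul_C_le _ _).trans natDegree_X_le

theorem amer_exists_div (x : Fin n → F[X]) (d : ℕ) (hx : ∀ k, (x k).natDegree ≤ d)
    (h : ∀ k, (x k).eval 0 = 0) :
    ∃ y : Fin n → F[X], x = (X : F[X]) • y ∧ ∀ k, (y k).natDegree ≤ d - 1 := by
  have : ∀ k, ∃ y : F[X], x k = X * y := fun k => by
    have := h k
    rw [← coeff_zero_eq_eval_zero] at this
    exact X_dvd_iff.mpr this
  choose y hy using this
  refine ⟨y, by ext1 k; simp [hy], fun k => ?_⟩
  have h2 := hx k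
  by_cases h0 : y k = 0
  · simp [h0]
  · rw [hy, natDegree_X_mul h0] at h2
    omega

theorem amer_reflect [CharZero F] (hA : A.IsSymm) (hB : B.IsSymm) {m : ℕ}
    (w : Fin m → Fin n → F[X])
    (hli : LinearIndependent F[X] w) (h0 : ∀ i j, amerPencil A B (w i) (w j) = 0)
    (d : Fin m → ℕ) (hd : ∀ i k, (w i k).natDegree ≤ d i) (i : Fin m)
    (hg : Matrix.toBilin' B (fun k => (w i k).eval 0) (fun k => (w i k).eval 0) ≠ 0) :
    ∃ (w' : Fin m → Fin n → F[X]) (d' : Fin m → ℕ),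
      LinearIndependent F[X] w' ∧ (∀ i j, amerPencil A B (w' i) (w' j) = 0) ∧
      (∀ i k, (w' i k).natDegree ≤ d' i) ∧ ∑ i, d' i < ∑ i, d i := by
  set u : Fin n → F := fun k => (w i k).eval 0 with hu
  set γ := Matrix.toBilin' B u u with hγ
  set U : Fin n → F[X] := fun k => C (u k) with hU
  have hsym := amerPencil_symm A B hA hB
  have hfu : Matrix.toBilin' A u u = 0 := by
    rw [← amerPencil_eval, h0]; simp
  have hUU : amerPencil A B U U = X * C γ := by
    rw [hU, amerPencil_C, hfu]; simp [hγ]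
  have hdi : 0 < d i := by
    rw [Nat.pos_iff_ne_zero]
    intro hdi
    have hw : w i = U := by
      ext1 k
      have := hd i k
      rw [hdi] at this
      rw [eq_C_of_natDegree_le_zero this, hU, hu]
      simp [coeff_zero_eq_eval_zero]
    have := h0 i i
    rw [hw, hUU] at this
    simp [hg] at this
  have hb : ∀ j, ∃ b : F[X], amerPencil A B (w j) U = X * b := fun j => by
    refine X_dvd_iff.mpr ?_
    rw [coeff_zero_eq_eval_zero, amerPencil_eval]
    have := congrArg (eval 0) (h0 j i)
    rw [amerPencil_eval] at this
    simpa [hU, hu] using this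
  choose b hb using hb
  have hbd : ∀ j, (b j).natDegree ≤ d j := fun j => by
    have := amerPencil_natDegree A B (w j) u (d j) (hd j)
    rw [← hU, hb] at this
    by_cases h : b j = 0
    · simp [h]
    · rw [natDegree_X_mul h] at this; omega
  obtain ⟨y, hy, -⟩ := amer_exists_div (w i - U) (d i) (fun k => by
      refine (natDegree_sub_le _ _).trans (max_le (hd i k) ?_)
      exact (natDegree_C _).le.trans (Nat.zero_le (d i))) (fun k => by simp [hU, hu])
  have hwi : w i = U + (X : F[X]) • y := by rw [← hy]; simp
  have hbi : b i = C γ + amerPencil A B y U := by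
    have := hb i
    rw [hwi] at this
    simp only [map_add, LinearMap.add_apply, map_smul, LinearMap.smul_apply, smul_eq_mul, hUU] at this
    rw [← mul_add] at this
    exact (mul_left_cancel₀ X_ne_zero this).symm
  have hq : C γ + 2 * amerPencil A B y U + X * amerPencil A B y y = 0 := by
    have := h0 i i
    rw [hwi] at this
    simp only [map_add, LinearMap.add_apply, map_smul, LinearMap.smul_apply, smul_eq_mul, hUU,
      hsym U y] at this
    refine (mul_eq_zero.mp (?_ : X * _ = 0)).resolve_left X_ne_zero
    rw [← this]; ring
  set w1 : Fin m → Fin n → F[X] := fun j => C γ • w j - (2 * b j) • U with hw1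
  have hγ0 : (C γ : F[X]) ≠ 0 := by simpa using hg
  have hli1 : LinearIndependent F[X] w1 := by
    rw [Fintype.linearIndependent_iff] at hli ⊢
    intro a ha
    have e1 : C γ • ∑ j, a j • w j = (2 * ∑ j, a j * b j) • U := by
      rw [← sub_eq_zero, ← ha]
      rw [Finset.smul_sum, Finset.mul_sum, Finset.sum_smul, ← Finset.sum_sub_distrib]
      refine Finset.sum_congr rfl fun j _ => ?_
      rw [hw1]
      simp only [smul_sub, smul_smul]
      congr 2 <;> ring
    have e2 := congrArg (fun z => amerPencil A B z U) e1
    simp only [map_smul, map_sum, LinearMap.smul_apply, LinearMap.sum_apply, smul_eq_mul, hb, hUU]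
      at e2
    have e3 : (∑ j, a j * b j) * (X * C γ) = 0 := by
      have e4 : ∑ j, a j * (X * b j) = X * ∑ j, a j * b j := by
        rw [Finset.mul_sum]; exact Finset.sum_congr rfl fun j _ => by ring
      rw [e4] at e2
      linear_combination -e2
    have e5 : ∑ j, a j * b j = 0 := by
      simpa [hγ0, hg, X_ne_zero] using e3
    rw [e5] at e1
    simp only [mul_zero, zero_smul] at e1
    exact hli a ((smul_eq_zero.mp e1).resolve_left hγ0)
  have h01 : ∀ j k, amerPencil A B (w1 j) (w1 k) = 0 := fun j k => by
    simp only [hw1, map_sub, LinearMap.sub_apply, map_smul, LinearMap.smul_apply, smul_eq_mul, hUU,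
      hb, h0, hsym U (w k)]
    ring
  have hd1 : ∀ j k, (w1 j k).natDegree ≤ d j := fun j k => by
    simp only [hw1, Pi.sub_apply, Pi.smul_apply, smul_eq_mul, hU]
    refine (natDegree_sub_le _ _).trans (max_le ((natDegree_C_mul_le _ _).trans (hd j k)) ?_)
    refine (natDegree_mul_C_le _ _).trans ?_
    refine (natDegree_C_mul_le (2 : F) _).trans (hbd j)
  obtain ⟨z, hz, hzd⟩ := amer_exists_div (w1 i) (d i) (hd1 i) (fun k => by
    have : w1 i = (X : F[X]) • (C γ • y + amerPencil A B y y • U) := by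
      have e : 2 * b i = C γ - X * amerPencil A B y y := by
        rw [hbi]; linear_combination hq
      simp only [hw1]
      rw [e, hwi]
      module
    rw [this]; simp)
  obtain ⟨g1, g2⟩ := amer_good_update (amerPencil A B) hsym w1 hli1 h01 i z X X_ne_zero
    (Pi.single i 1) (by simp) (by
      rw [← hz, Finset.sum_eq_single i] <;> simp +contextual)
  refine ⟨_, Function.update d i (d i - 1), g1, g2, ?_, ?_⟩
  · intro j k
    by_cases h : j = i
    · subst h; simpa using hzd k
    · simpa [h] using hd1 j k
  · refine Finset.sum_lt_sum (fun j _ => ?_) ⟨i, Finset.mem_univ _, ?_⟩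
    · by_cases h : j = i
      · subst h; simp
      · simp [h]
    · simp; omega

theorem amer_main [CharZero F] (hA : A.IsSymm) (hB : B.IsSymm) {m : ℕ}
    (w : Fin m → Fin n → F[X])
    (hli : LinearIndependent F[X] w) (h0 : ∀ i j, amerPencil A B (w i) (w j) = 0) :
    ∃ W : Submodule F (Fin n → F), Module.finrank F W = m ∧
      ∀ x ∈ W, Matrix.toBilin' A x x = 0 ∧ Matrix.toBilin' B x x = 0 := by
  classical
  have hsym := amerPencil_symm A B hA hB
  obtain ⟨d, hd⟩ : ∃ d : Fin m → ℕ, ∀ i k, (w i k).natDegree ≤ d i :=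
    ⟨fun i => Finset.univ.sup fun k => (w i k).natDegree,
      fun i k => Finset.le_sup (f := fun k => (w i k).natDegree) (Finset.mem_univ k)⟩
  induction hN : ∑ i, d i using Nat.strong_induction_on generalizing w d with
  | _ N ih =>
  by_cases hex : ∃ (w' : Fin m → Fin n → F[X]) (d' : Fin m → ℕ),
      LinearIndependent F[X] w' ∧ (∀ i j, amerPencil A B (w' i) (w' j) = 0) ∧
      (∀ i k, (w' i k).natDegree ≤ d' i) ∧ ∑ i, d' i < ∑ i, d i
  · obtain ⟨w', d', h1, h2, h3, h4⟩ := hex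
    exact ih _ (hN ▸ h4) w' h1 h2 d' h3 rfl
  have key : ∀ c : Fin m → F, c ≠ 0 → (fun k => (∑ j, c j • (w j k).eval 0)) ≠ 0 ∧
      Matrix.toBilin' B (fun k => (∑ j, c j • (w j k).eval 0))
        (fun k => (∑ j, c j • (w j k).eval 0)) = 0 := by
    intro c hc
    obtain ⟨i0, hi0⟩ := Function.ne_iff.mp hc
    obtain ⟨i, hi, hmax⟩ := Finset.exists_max_image (Finset.univ.filter fun j => c j ≠ 0) d
      ⟨i0, by simpa using hi0⟩
    have hci : c i ≠ 0 := by simpa using hi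
    set v : Fin n → F[X] := ∑ j, C (c j) • w j with hv
    have hve : ∀ k, (v k).eval 0 = ∑ j, c j • (w j k).eval 0 := fun k => by
      simp [hv, eval_finsetSum]
    have hvd : ∀ k, (v k).natDegree ≤ d i := fun k => by
      simp only [hv, Finset.sum_apply, Pi.smul_apply, smul_eq_mul]
      refine natDegree_sum_le_of_forall_le _ _ fun j _ => ?_
      by_cases h : c j = 0
      · simp [h]
      · exact (natDegree_C_mul_le _ _).trans ((hd j k).trans (hmax j (by simpa using h)))
    constructor
    · intro hz
      have hz' : ∀ k, (v k).eval 0 = 0 := fun k => by rw [hve]; exact congrFun hz k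
      by_cases hdi : d i = 0
      · have hv0 : v = 0 := by
          ext1 k
          have h1 := hvd k
          rw [hdi] at h1
          rw [eq_C_of_natDegree_le_zero h1, coeff_zero_eq_eval_zero, hz']
          simp
        have := Fintype.linearIndependent_iff.mp hli _ (hv.symm.trans hv0) i
        simp [hci] at this
      · obtain ⟨z, hz, hzd⟩ := amer_exists_div v (d i) hvd hz'
        obtain ⟨g1, g2⟩ := amer_good_update (amerPencil A B) hsym w hli h0 i z X X_ne_zero
          (fun j => C (c j)) (by simpa using hci) (by rw [← hz])
        refine hex ⟨_, Function.update d i (d i - 1), g1, g2, ?_, ?_⟩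
        · intro j k
          by_cases h : j = i
          · subst h; simpa using hzd k
          · simpa [h] using hd j k
        · refine Finset.sum_lt_sum (fun j _ => ?_) ⟨i, Finset.mem_univ _, ?_⟩
          · by_cases h : j = i
            · subst h; simp
            · simp [h]
          · simp; omega
    · by_contra hg
      obtain ⟨g1, g2⟩ := amer_good_update (amerPencil A B) hsym w hli h0 i v 1 one_ne_zero
          (fun j => C (c j)) (by simpa using hci) (by rw [one_smul])
      refine hex (amer_reflect A B hA hB _ g1 g2 d ?_ i ?_)
      · intro j k
        by_cases h : j = i
        · subst h; simpa using hvd k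
        · simpa [h] using hd j k
      · simpa only [Function.update_self, hve] using hg
  let φ : (Fin m → F) →ₗ[F] (Fin n → F) :=
    Fintype.linearCombination F (fun j k => (w j k).eval 0)
  have hφ : ∀ c, φ c = fun k => (∑ j, c j • (w j k).eval 0) := fun c => by
    ext k; simp [φ, Fintype.linearCombination_apply]
  refine ⟨LinearMap.range φ, ?_, ?_⟩
  · rw [LinearMap.finrank_range_of_inj]
    · simp
    · rw [← LinearMap.ker_eq_bot, LinearMap.ker_eq_bot']
      intro c hc
      by_contra h
      exact (key c h).1 ((hφ c).symm.trans hc)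
  · rintro x ⟨c, rfl⟩
    constructor
    · have h1 : amerPencil A B (∑ j, C (c j) • w j) (∑ j, C (c j) • w j) = 0 := by
        simp [h0]
      have h2 := congrArg (eval 0) h1
      rw [amerPencil_eval] at h2
      rw [hφ]
      simpa [eval_finsetSum] using h2
    · by_cases hc : c = 0
      · simp [hc]
      · rw [hφ]; exact (key c hc).2

end

end AmerPart

section HypPart
open Matrix

theorem hyp_exists_dual {K : Type*} [Field K] [CharZero K] {n k : ℕ}
    (M : Matrix (Fin n) (Fin n) K) (hM : M.IsSymm) (hdet : M.det ≠ 0)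
    (W : Matrix (Fin n) (Fin k) K) (L : Matrix (Fin k) (Fin n) K) (hL : L * W = 1)
    (hW : Wᵀ * M * W = 0) :
    ∃ U : Matrix (Fin n) (Fin k) K, Wᵀ * M * U = 1 ∧ Uᵀ * M * W = 1 ∧ Uᵀ * M * U = 0 := by
  have hu : IsUnit M.det := isUnit_iff_ne_zero.mpr hdet
  set U := M⁻¹ * Lᵀ with hU
  have h1 : Wᵀ * M * U = 1 := by
    rw [hU, Matrix.mul_assoc, ← Matrix.mul_assoc M, Matrix.mul_nonsing_inv _ hu, Matrix.one_mul,
      ← Matrix.transpose_mul, hL, Matrix.transpose_one]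
  have h2 : Uᵀ * M * W = 1 := by
    have := congrArg Matrix.transpose h1
    simpa [Matrix.transpose_mul, hM.eq, Matrix.mul_assoc] using this
  clear_value U
  set S := Uᵀ * M * U with hS
  have hSt : Sᵀ = S := by
    simp [hS, Matrix.transpose_mul, hM.eq, Matrix.mul_assoc]
  refine ⟨U - (1/2 : K) • (W * S), ?_, ?_, ?_⟩
  · rw [Matrix.mul_sub, h1, Matrix.mul_smul, ← Matrix.mul_assoc, hW]; simp
  · rw [Matrix.transpose_sub, Matrix.transpose_smul, Matrix.transpose_mul, Matrix.sub_mul,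
      Matrix.sub_mul, h2, Matrix.smul_mul, Matrix.smul_mul, Matrix.mul_assoc, Matrix.mul_assoc,
      ← Matrix.mul_assoc Wᵀ, hW]; simp
  · rw [Matrix.transpose_sub, Matrix.transpose_smul, Matrix.transpose_mul, hSt]
    have e1 : S * Wᵀ * M * U = S := by
      rw [Matrix.mul_assoc, Matrix.mul_assoc, ← Matrix.mul_assoc Wᵀ, h1, Matrix.mul_one]
    have e2 : S * Wᵀ * M * (W * S) = 0 := by
      rw [← Matrix.mul_assoc, Matrix.mul_assoc S, Matrix.mul_assoc S, hW]; simp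
    have e3 : Uᵀ * M * (W * S) = S := by
      rw [← Matrix.mul_assoc, h2, Matrix.one_mul]
    simp only [Matrix.sub_mul, Matrix.mul_sub, Matrix.smul_mul, Matrix.mul_smul, e1, e2, e3, ← hS]
    module

theorem hyp_prod {K : Type*} [Field K] (k : ℕ) (c : K) :
    ∏ i : Fin (2 * k + 1), (if (i : ℕ) < 2 * k then (-1 : K) ^ (i : ℕ) else c) = (-1) ^ k * c := by
  rw [Fin.prod_univ_castSucc]
  simp only [Fin.val_castSucc, Fin.is_lt, if_true, Fin.val_last, lt_irrefl, if_false]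
  congr 1
  rw [Fin.prod_univ_eq_prod_range (fun i => (-1 : K) ^ i)]
  induction k with
  | zero => simp
  | succ k ih =>
    rw [Nat.mul_succ, Finset.prod_range_succ, Finset.prod_range_succ, ih]
    simp [pow_succ, pow_mul]

theorem hyp_main {K : Type*} [Field K] [CharZero K] {k : ℕ}
    (M : Matrix (Fin (2 * k + 1)) (Fin (2 * k + 1)) K) (hM : M.IsSymm) (hdet : M.det ≠ 0)
    (W : Matrix (Fin (2 * k + 1)) (Fin k) K) (L : Matrix (Fin k) (Fin (2 * k + 1)) K)
    (hL : L * W = 1) (hW : Wᵀ * M * W = 0) :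
    ∃ P : Matrix (Fin (2 * k + 1)) (Fin (2 * k + 1)) K, IsUnit P.det ∧
      Pᵀ * M * P = Matrix.diagonal (fun i : Fin (2 * k + 1) =>
        if (i : ℕ) < 2 * k then (-1 : K) ^ (i : ℕ) else (-1) ^ k * M.det) := by
  obtain ⟨U, hWU, hUW, hUU⟩ := hyp_exists_dual M hM hdet W L hL hW
  let β : LinearMap.BilinForm K (Fin (2 * k + 1) → K) := Matrix.toBilin' M
  have hβ : ∀ x y, β x y = x ⬝ᵥ (M *ᵥ y) := fun x y => Matrix.toBilin'_apply' M x y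
  have hsym : ∀ x y, β x y = β y x := fun x y => by
    rw [hβ, hβ, Matrix.dotProduct_mulVec, ← Matrix.mulVec_transpose, hM.eq, dotProduct_comm]
  have hent : ∀ {a b : ℕ} (P : Matrix (Fin (2 * k + 1)) (Fin a) K)
      (Q : Matrix (Fin (2 * k + 1)) (Fin b) K) i j,
      (Pᵀ * M * Q) i j = β (P.col i) (Q.col j) := fun P Q i j => by
    rw [hβ, Matrix.mul_assoc, Matrix.mul_apply]
    rfl
  let w := W.col
  let u := U.col
  have hww : ∀ i j, β (w i) (w j) = 0 := fun i j => by rw [← hent, hW]; rfl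
  have huu : ∀ i j, β (u i) (u j) = 0 := fun i j => by rw [← hent, hUU]; rfl
  have hwu : ∀ i j, β (w i) (u j) = if i = j then 1 else 0 := fun i j => by
    rw [← hent, hWU, Matrix.one_apply]
  have huw : ∀ i j, β (u i) (w j) = if i = j then 1 else 0 := fun i j => by
    rw [← hent, hUW, Matrix.one_apply]
  obtain ⟨z, hz0, hz⟩ : ∃ z, z ≠ 0 ∧ ∀ i, β (w i) z = 0 ∧ β (u i) z = 0 := by
    let φ : (Fin (2 * k + 1) → K) →ₗ[K] (Fin k → K) × (Fin k → K) :=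
      (LinearMap.pi fun i => β (w i)).prod (LinearMap.pi fun i => β (u i))
    have h : LinearMap.ker φ ≠ ⊥ := LinearMap.ker_ne_bot_of_finrank_lt (by simp; omega)
    obtain ⟨z, hz, hz0⟩ := Submodule.exists_mem_ne_zero_of_ne_bot h
    refine ⟨z, hz0, fun i => ?_⟩
    have hz' : φ z = 0 := hz
    exact ⟨congrFun (congrArg Prod.fst hz') i, congrFun (congrArg Prod.snd hz') i⟩
  -- the family of columns, with last column a multiple of `z`
  let p : K → Fin (2 * k + 1) → (Fin (2 * k + 1) → K) := fun s i =>
    if h : (i : ℕ) < 2 * k then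
      w ⟨i / 2, by omega⟩ + ((-1 : K) ^ (i : ℕ) / 2) • u ⟨i / 2, by omega⟩
    else s • z
  have hp : ∀ s i j, β (p s i) (p s j) = Matrix.diagonal (fun i : Fin (2 * k + 1) =>
        if (i : ℕ) < 2 * k then (-1 : K) ^ (i : ℕ) else s ^ 2 * β z z) i j := by
    intro s i j
    by_cases hi : (i : ℕ) < 2 * k <;> by_cases hj : (j : ℕ) < 2 * k
    · simp only [p, hi, hj, dif_pos, map_add, map_smul, LinearMap.add_apply, LinearMap.smul_apply,
        hww, huu, hwu, huw, smul_eq_mul, Fin.mk.injEq]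
      by_cases hij : i = j
      · subst hij; simp [hi]
      · rw [Matrix.diagonal_apply_ne _ hij]
        by_cases h2 : (i : ℕ) / 2 = (j : ℕ) / 2
        · have hne : (i : ℕ) ≠ j := fun h => hij (Fin.ext h)
          have : (i : ℕ) = j + 1 ∨ (j : ℕ) = i + 1 := by omega
          simp only [h2, if_true]
          rcases this with h | h <;> rw [h, pow_succ] <;> ring
        · have h3 : ¬ (j : ℕ) / 2 = (i : ℕ) / 2 := fun h => h2 h.symm
          simp [h2]
    · have hij : i ≠ j := fun h => hj (h ▸ hi)
      rw [Matrix.diagonal_apply_ne _ hij]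
      simp only [p, hi, hj, dif_pos, dif_neg, not_false_eq_true, map_add, map_smul,
        LinearMap.add_apply, LinearMap.smul_apply, (hz _).1, (hz _).2]
      simp
    · have hij : i ≠ j := fun h => hi (h ▸ hj)
      rw [Matrix.diagonal_apply_ne _ hij]
      simp only [p, hi, hj, dif_pos, dif_neg, not_false_eq_true, map_add, map_smul,
        LinearMap.smul_apply, hsym z, (hz _).1, (hz _).2]
      simp
    · have hij : i = j := Fin.ext (by omega)
      subst hij
      simp only [p, hi, dif_neg, not_false_eq_true, map_smul, LinearMap.smul_apply,
        Matrix.diagonal_apply_eq, if_neg, smul_eq_mul]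
      ring
  let P : K → Matrix (Fin (2 * k + 1)) (Fin (2 * k + 1)) K := fun s => Matrix.of fun a b => p s b a
  have hP : ∀ s, (P s)ᵀ * M * P s = Matrix.diagonal (fun i : Fin (2 * k + 1) =>
        if (i : ℕ) < 2 * k then (-1 : K) ^ (i : ℕ) else s ^ 2 * β z z) := fun s => by
    ext i j
    rw [hent, ← hp]
    rfl
  have hPdet : ∀ s, s ≠ 0 → (P s).det ≠ 0 := by
    intro s hs h
    obtain ⟨x, hx0, hx⟩ := Matrix.exists_mulVec_eq_zero_iff.mpr h
    have h1 : ((P s)ᵀ * M * P s) *ᵥ x = 0 := by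
      rw [← Matrix.mulVec_mulVec, hx, Matrix.mulVec_zero]
    rw [hP] at h1
    have h2 : ∀ i : Fin (2 * k + 1), (i : ℕ) < 2 * k → x i = 0 := fun i hi => by
      have := congrFun h1 i
      simpa [Matrix.mulVec_diagonal, hi] using this
    have h3 : ∀ a, x (Fin.last _) * (s * z a) = 0 := fun a => by
      have := congrFun hx a
      simp only [Matrix.mulVec, dotProduct] at this
      rw [Finset.sum_eq_single (Fin.last _)] at this
      · simpa [P, p, mul_comm] using this
      · intro b _ hb
        rw [h2 b, mul_zero]
        have : (b : ℕ) ≠ 2 * k := fun h => hb (Fin.ext h)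
        omega
      · simp
    obtain ⟨a, ha⟩ := Function.ne_iff.mp hz0
    have h4 : x (Fin.last _) = 0 := by
      refine (mul_eq_zero.mp (h3 a)).resolve_right (mul_ne_zero hs ha)
    apply hx0
    ext i
    by_cases hi : (i : ℕ) < 2 * k
    · exact h2 i hi
    · have : i = Fin.last _ := Fin.ext (by simp; omega)
      rw [this, h4]; rfl
  set D := (P 1).det with hD
  have hD0 : D ≠ 0 := hPdet 1 one_ne_zero
  have hc : D * M.det * D = (-1) ^ k * β z z := by
    have := congrArg Matrix.det (hP 1)
    rw [Matrix.det_mul, Matrix.det_mul, Matrix.det_transpose, Matrix.det_diagonal, hyp_prod] at this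
    simpa using this
  refine ⟨P D⁻¹, isUnit_iff_ne_zero.mpr (hPdet _ (inv_ne_zero hD0)), ?_⟩
  rw [hP]
  have : D⁻¹ ^ 2 * β z z = (-1) ^ k * M.det := by
    have h1 : ((-1 : K) ^ k) * (-1) ^ k = 1 := by rw [← mul_pow]; simp
    field_simp
    linear_combination (-(-1 : K) ^ k) * hc - (β z z) * h1
  rw [this]

theorem hyp_equiv {K : Type*} [Field K] {n : ℕ} (M : Matrix (Fin n) (Fin n) K)
    (P : Matrix (Fin n) (Fin n) K) (hP : IsUnit P.det) (D : Fin n → K)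
    (h : Pᵀ * M * P = Matrix.diagonal D) :
    QuadraticMap.Equivalent M.toQuadraticForm' (QuadraticMap.weightedSumSquares K D) := by
  refine QuadraticMap.Equivalent.symm ⟨⟨Matrix.toLinearEquiv' P (P.invertibleOfIsUnitDet hP), ?_⟩⟩
  intro x
  change M.toQuadraticForm' (P *ᵥ x) = _
  have h1 : M.toQuadraticForm' (P *ᵥ x) = (P *ᵥ x) ⬝ᵥ (M *ᵥ (P *ᵥ x)) := by
    simp [Matrix.toQuadraticForm', LinearMap.BilinMap.toQuadraticMap_apply,
      Matrix.toLinearMap₂'_apply']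
  have h2 : (P *ᵥ x) ⬝ᵥ (M *ᵥ (P *ᵥ x)) = x ⬝ᵥ ((Pᵀ * M * P) *ᵥ x) := by
    rw [← Matrix.mulVec_mulVec, ← Matrix.mulVec_mulVec, Matrix.dotProduct_mulVec x, Matrix.vecMul_transpose]
  rw [h1, h2, h, QuadraticMap.weightedSumSquares_apply]
  simp only [dotProduct, Matrix.mulVec_diagonal, smul_eq_mul]
  exact Finset.sum_congr rfl fun i _ => by ring

end HypPart

section FinalPart
open Matrix Polynomial

theorem fin_quad_apply {K : Type*} [Field K] {n : ℕ} (M : Matrix (Fin n) (Fin n) K)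
    (x : Fin n → K) : M.toQuadraticForm' x = Matrix.toBilin' M x x := by
  rw [Matrix.toBilin'_apply']
  simp [Matrix.toQuadraticForm', LinearMap.BilinMap.toQuadraticMap_apply,
      Matrix.toLinearMap₂'_apply']

theorem fin_symm_ext {K : Type*} [Field K] [CharZero K] {n : ℕ} (M N : Matrix (Fin n) (Fin n) K)
    (hM : M.IsSymm) (hN : N.IsSymm)
    (h : ∀ x, Matrix.toBilin' M x x = Matrix.toBilin' N x x) : M = N := by
  ext i j
  have h1 := h (Pi.single i 1 + Pi.single j 1)
  have h2 := h (Pi.single i 1)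
  have h3 := h (Pi.single j 1)
  simp only [map_add, LinearMap.add_apply, Matrix.toBilin'_single] at h1 h2 h3
  rw [hM.apply i j, hN.apply i j] at h1
  have h4 : (2 : K) * M i j = 2 * N i j := by linear_combination h1 - h2 - h3
  exact mul_left_cancel₀ two_ne_zero h4

theorem fin_bilin_conj {K : Type*} [Field K] {n k : ℕ} (M : Matrix (Fin n) (Fin n) K)
    (P : Matrix (Fin n) (Fin k) K) (x y : Fin k → K) :
    Matrix.toBilin' (Pᵀ * M * P) x y = Matrix.toBilin' M (P *ᵥ x) (P *ᵥ y) := by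
  rw [Matrix.toBilin'_apply', Matrix.toBilin'_apply',
    ← Matrix.mulVec_mulVec, ← Matrix.mulVec_mulVec, Matrix.dotProduct_mulVec x,
    Matrix.vecMul_transpose]

theorem fin_conj_symm {K : Type*} [Field K] {n k : ℕ} (M : Matrix (Fin n) (Fin n) K)
    (hM : M.IsSymm) (P : Matrix (Fin n) (Fin k) K) : (Pᵀ * M * P).IsSymm := by
  simp [Matrix.IsSymm, Matrix.transpose_mul, hM.eq, Matrix.mul_assoc]

/-- Direction from subspaces to matrices. -/
theorem fin_subspace_matrix {F : Type*} [Field F] [CharZero F] {n k : ℕ}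
    (A B : Matrix (Fin n) (Fin n) F) (hA : A.IsSymm) (hB : B.IsSymm)
    (W : Submodule F (Fin n → F)) (hW : Module.finrank F W = k)
    (h : ∀ x ∈ W, Matrix.toBilin' A x x = 0 ∧ Matrix.toBilin' B x x = 0) :
    ∃ (W0 : Matrix (Fin n) (Fin k) F) (L0 : Matrix (Fin k) (Fin n) F), L0 * W0 = 1 ∧
      W0ᵀ * A * W0 = 0 ∧ W0ᵀ * B * W0 = 0 := by
  let b := Module.finBasisOfFinrankEq F W hW
  let φ : (Fin k → F) →ₗ[F] (Fin n → F) := W.subtype ∘ₗ b.equivFun.symm.toLinearMap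
  have hφ : LinearMap.ker φ = ⊥ := by
    rw [LinearMap.ker_eq_bot]
    exact W.injective_subtype.comp b.equivFun.symm.injective
  obtain ⟨ψ, hψ⟩ := φ.exists_leftInverse_of_injective hφ
  have hmem : ∀ c, (LinearMap.toMatrix' φ) *ᵥ c ∈ W := fun c => by
    rw [LinearMap.toMatrix'_mulVec]
    exact (b.equivFun.symm c).2
  refine ⟨LinearMap.toMatrix' φ, LinearMap.toMatrix' ψ, ?_, ?_, ?_⟩
  · rw [← LinearMap.toMatrix'_comp, hψ, LinearMap.toMatrix'_id]
  · refine fin_symm_ext _ _ (fin_conj_symm A hA _) Matrix.isSymm_zero fun c => ?_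
    rw [fin_bilin_conj, (h _ (hmem c)).1]; simp
  · refine fin_symm_ext _ _ (fin_conj_symm B hB _) Matrix.isSymm_zero fun c => ?_
    rw [fin_bilin_conj, (h _ (hmem c)).2]; simp

theorem fin_clear {F : Type*} [Field F] {n m : ℕ}
    (A B : Matrix (Fin n) (Fin n) F)
    (x : Fin m → Fin n → RatFunc F) (hli : LinearIndependent (RatFunc F) x)
    (h0 : ∀ i j, Matrix.toBilin' (A.map (algebraMap F (RatFunc F)) +
      (RatFunc.X : RatFunc F) • B.map (algebraMap F (RatFunc F))) (x i) (x j) = 0) :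
    ∃ p : Fin m → Fin n → F[X], LinearIndependent F[X] p ∧
      ∀ i j, amerPencil A B (p i) (p j) = 0 := by
  obtain ⟨a, ha⟩ := IsLocalization.exist_integer_multiples_of_finite (nonZeroDivisors F[X])
    (fun jk : Fin m × Fin n => x jk.1 jk.2)
  have ha' : ∀ j k, ∃ p : F[X], algebraMap F[X] (RatFunc F) p = algebraMap F[X] (RatFunc F) a * x j k :=
    fun j k => by
      obtain ⟨p, hp⟩ := ha (j, k)
      exact ⟨p, by rw [hp, Algebra.smul_def]⟩
  choose p hp using ha'
  have hinj : Function.Injective (algebraMap F[X] (RatFunc F)) :=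
    IsFractionRing.injective F[X] (RatFunc F)
  have ha0 : algebraMap F[X] (RatFunc F) a ≠ 0 := by
    rw [Ne, map_eq_zero_iff _ hinj]
    exact nonZeroDivisors.coe_ne_zero a
  refine ⟨p, ?_, fun i j => ?_⟩
  · rw [Fintype.linearIndependent_iff] at hli ⊢
    intro c hc i
    have := hli (fun j => algebraMap F[X] (RatFunc F) (c j) * algebraMap F[X] (RatFunc F) a) (by
      ext k
      have h1 := congrArg (algebraMap F[X] (RatFunc F)) (congrFun hc k)
      simp only [Finset.sum_apply, Pi.smul_apply, smul_eq_mul, map_sum, map_mul, hp, Pi.zero_apply,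
        map_zero] at h1 ⊢
      rw [← h1]
      exact Finset.sum_congr rfl fun j _ => by ring) i
    have h2 := (mul_eq_zero.mp this).resolve_right ha0
    rwa [map_eq_zero_iff _ hinj] at h2
  · apply hinj
    have h1 := h0 i j
    rw [Matrix.toBilin'_apply] at h1
    rw [amerPencil_apply, map_zero,
      ← mul_zero (algebraMap F[X] (RatFunc F) a * algebraMap F[X] (RatFunc F) a), ← h1]
    simp only [map_sum, Finset.mul_sum, map_mul, map_add, hp, RatFunc.algebraMap_X,
      RatFunc.algebraMap_C, Matrix.add_apply, Matrix.smul_apply, Matrix.map_apply, smul_eq_mul,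
      RatFunc.algebraMap_eq_C]
    exact Finset.sum_congr rfl fun _ _ => Finset.sum_congr rfl fun _ _ => by ring

theorem fin_isotropic {K : Type*} [Field K] [CharZero K] {k : ℕ}
    (M : Matrix (Fin (2 * k + 1)) (Fin (2 * k + 1)) K) (hM : M.IsSymm) (c : K)
    (h : QuadraticMap.Equivalent M.toQuadraticForm' (QuadraticMap.weightedSumSquares K
      (fun i : Fin (2 * k + 1) => if (i : ℕ) < 2 * k then (-1 : K) ^ (i : ℕ) else c))) :
    ∃ x : Fin k → Fin (2 * k + 1) → K, LinearIndependent K x ∧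
      ∀ i j, Matrix.toBilin' M (x i) (x j) = 0 := by
  obtain ⟨e⟩ := h.symm
  set D : Fin (2 * k + 1) → K := fun i => if (i : ℕ) < 2 * k then (-1 : K) ^ (i : ℕ) else c with hD
  let E := LinearMap.toMatrix' (e.toLinearEquiv.toLinearMap)
  have hE : ∀ v, E *ᵥ v = e v := fun v => LinearMap.toMatrix'_mulVec _ _
  have hdiag : Eᵀ * M * E = Matrix.diagonal D := by
    refine fin_symm_ext _ _ (fin_conj_symm M hM _) (Matrix.isSymm_diagonal D) fun v => ?_
    rw [fin_bilin_conj, hE, ← fin_quad_apply, e.map_app, QuadraticMap.weightedSumSquares_apply,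
      Matrix.toBilin'_apply']
    simp only [dotProduct, Matrix.mulVec_diagonal, smul_eq_mul]
    exact Finset.sum_congr rfl fun i _ => by ring
  let v : Fin k → Fin (2 * k + 1) → K := fun j i => if (i : ℕ) / 2 = j then 1 else 0
  have hv : LinearIndependent K v := by
    rw [Fintype.linearIndependent_iff]
    intro a ha i
    have := congrFun ha ⟨2 * i, by omega⟩
    simpa [v, Fin.val_inj] using this
  refine ⟨fun j => e (v j), ?_, fun i j => ?_⟩
  · exact hv.map' e.toLinearEquiv.toLinearMap (LinearEquiv.ker _)
  · change Matrix.toBilin' M (e (v i)) (e (v j)) = 0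
    rw [← hE, ← hE, ← fin_bilin_conj, hdiag, Matrix.toBilin'_apply']
    simp only [dotProduct, Matrix.mulVec_diagonal]
    by_cases hij : i = j
    · subst hij
      rw [Finset.sum_eq_add (⟨2 * i, by omega⟩ : Fin (2 * k + 1)) ⟨2 * i + 1, by omega⟩]
      · have h1 : 2 * (i : ℕ) < 2 * k := by omega
        have h2 : 2 * (i : ℕ) + 1 < 2 * k := by omega
        have h3 : (2 * (i : ℕ) + 1) / 2 = i := by omega
        simp [v, D, h1, h2, h3, pow_succ]
      · simp
      · intro l _ hl
        have h1 : (l : ℕ) / 2 ≠ i := by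
          intro h
          have h1 : (l : ℕ) ≠ 2 * i := fun h => hl.1 (Fin.ext h)
          have h2 : (l : ℕ) ≠ 2 * i + 1 := fun h => hl.2 (Fin.ext h)
          omega
        simp [v, h1]
      · simp
      · simp
    · refine Finset.sum_eq_zero fun l _ => ?_
      by_cases h1 : (l : ℕ) / 2 = i
      · have h2 : (l : ℕ) / 2 ≠ j := fun h => hij (Fin.ext (h1.symm.trans h))
        simp [v, h2]
      · simp [v, h1]

end FinalPart

/-- Let `F` be a field of characteristic `0`, and let `f`, `g` be quadratic forms on
`F^{2r+3}` whose pencil `f + t•g` over `F(t)` is nondegenerate, with Gram matrix `M`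
(the symmetric matrix representing `f + t•g` in the standard basis) of determinant
`δ ∈ F(t)ˣ`. Then `f` and `g` vanish identically on a common `(r+1)`-dimensional linear
subspace of `F^{2r+3}` iff `f + t•g` is equivalent over `F(t)` to the orthogonal sum of
`r+1` hyperbolic planes `⟨1, -1⟩` and the one-dimensional form `⟨(-1)^(r+1) δ⟩`. -/
theorem vanishing_subspace_iff_pencil_hyperbolic_plus_discriminant
    (F : Type*) [Field F] [CharZero F] (r : ℕ)
    (f g : QuadraticForm F (Fin (2 * r + 3) → F))
    (hnd : LinearMap.BilinForm.Nondegenerate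
      (f.mapBase (algebraMap F (RatFunc F)) +
        (RatFunc.X : RatFunc F) • g.mapBase (algebraMap F (RatFunc F))).polarBilin)
    (M : Matrix (Fin (2 * r + 3)) (Fin (2 * r + 3)) (RatFunc F)) (hMsymm : M.IsSymm)
    (hMq : M.toQuadraticMap' =
      f.mapBase (algebraMap F (RatFunc F)) +
        (RatFunc.X : RatFunc F) • g.mapBase (algebraMap F (RatFunc F)))
    (δ : (RatFunc F)ˣ) (hδ : M.det = (δ : RatFunc F)) :
    (∃ W : Submodule F (Fin (2 * r + 3) → F),
        Module.finrank F ↥W = r + 1 ∧ ∀ x ∈ W, f x = 0 ∧ g x = 0) ↔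
      QuadraticMap.Equivalent
        (f.mapBase (algebraMap F (RatFunc F)) +
          (RatFunc.X : RatFunc F) • g.mapBase (algebraMap F (RatFunc F)))
        (QuadraticMap.weightedSumSquares (RatFunc F)
          (fun i : Fin (2 * r + 3) =>
            if (i : ℕ) < 2 * (r + 1) then (-1 : RatFunc F) ^ (i : ℕ)
            else (-1 : RatFunc F) ^ (r + 1) * (δ : RatFunc F))) := by
  
  have hquad : ∀ q : QuadraticForm F (Fin (2 * r + 3) → F), ∀ x,
      Matrix.toBilin' (QuadraticForm.toMatrix' q) x x = q x := by
    intro q x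
    rw [QuadraticForm.toMatrix', Matrix.toBilin'_apply', ← Matrix.toLinearMap₂'_apply',
      Matrix.toLinearMap₂'_toMatrix']
    exact QuadraticMap.associated_eq_self_apply F q x
  set A := QuadraticForm.toMatrix' f with hA
  set B := QuadraticForm.toMatrix' g with hB
  have hAs : A.IsSymm := QuadraticForm.isSymm_toMatrix' f
  have hBs : B.IsSymm := QuadraticForm.isSymm_toMatrix' g
  have hMN : M = A.map (algebraMap F (RatFunc F)) +
      (RatFunc.X : RatFunc F) • B.map (algebraMap F (RatFunc F)) := by
    refine fin_symm_ext _ _ hMsymm ((hAs.map _).add ((hBs.map _).smul _)) fun x => ?_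
    have h1 := congrArg (fun q => q x) hMq
    have h2 : M.toQuadraticMap' x = Matrix.toBilin' M x x := fin_quad_apply M x
    have h3 : f.mapBase (algebraMap F (RatFunc F)) x =
      Matrix.toBilin' (A.map (algebraMap F (RatFunc F))) x x := fin_quad_apply _ x
    have h4 : g.mapBase (algebraMap F (RatFunc F)) x =
      Matrix.toBilin' (B.map (algebraMap F (RatFunc F))) x x := fin_quad_apply _ x
    simp only [add_apply, smul_apply, h2, h3, h4] at h1
    rw [h1]
    simp
  rw [← hMq]
  constructor
  · rintro ⟨W, hW, h⟩
    obtain ⟨W0, L0, h1, h2, h3⟩ := fin_subspace_matrix A B hAs hBs W hW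
      (fun x hx => by rw [hquad, hquad]; exact h x hx)
    obtain ⟨P, hP, hPM⟩ := hyp_main (k := r + 1) M hMsymm (by rw [hδ]; exact δ.ne_zero)
      (W0.map (algebraMap F (RatFunc F))) (L0.map (algebraMap F (RatFunc F)))
      (by rw [← Matrix.map_mul, h1]; simp)
      (by
        rw [hMN, ← Matrix.transpose_map, Matrix.mul_add, Matrix.add_mul, Matrix.mul_smul,
          Matrix.smul_mul, ← Matrix.map_mul, ← Matrix.map_mul, ← Matrix.map_mul, ← Matrix.map_mul,
          h2, h3]
        simp)
    rw [hδ] at hPM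
    exact hyp_equiv M P hP _ hPM
  · intro h
    obtain ⟨x, hx, hx0⟩ := fin_isotropic (k := r + 1) M hMsymm _ h
    rw [hMN] at hx0
    obtain ⟨p, hp, hp0⟩ := fin_clear A B x hx hx0
    obtain ⟨W, hW, hW0⟩ := amer_main A B hAs hBs p hp hp0
    refine ⟨W, hW, fun y hy => ?_⟩
    rw [← hquad f, ← hquad g]
    exact hW0 y hy
end

section
/- Let F be a field of characteristic 0 and let r ≥ 0 be an integer. Let f and g be quadratic forms on F^{2r+2} such that the quadratic form f + t·g on F(t)^{2r+2} over the rational function field F(t) is nondegenerate. Then there exists an (r+1)-dimensional F-linear subspace of F^{2r+2} on which both f and g vanish identically if and only if the quadratic form f + t·g over F(t) is equivalent to the orthogonal sum of r+1 copies of the hyperbolic plane H = <1, -1> (i.e., f + t·g is hyperbolic over F(t)). -/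
namespace AmerAux

open Module

/-- A nondegenerate form with a totally isotropic subspace of half dimension is hyperbolic. -/
theorem hyperbolic_of_isotropic {K V : Type*} [Field K] [CharZero K] [AddCommGroup V] [Module K V]
    [FiniteDimensional K V] (r : ℕ) (hV : finrank K V = 2 * r + 2) (Q : QuadraticForm K V)
    (hnd : LinearMap.BilinForm.Nondegenerate Q.polarBilin) (L : Submodule K V)
    (hL : finrank K L = r + 1) (hQ : ∀ x ∈ L, Q x = 0) :
    QuadraticMap.Equivalent Q (QuadraticMap.weightedSumSquares K
      (fun i : Fin (2 * r + 2) => (-1 : K) ^ (i : ℕ))) := by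
  classical
  set B := Q.polarBilin with hB
  have Bsymm : ∀ x y, B x y = B y x := fun x y => QuadraticMap.polar_comm Q x y
  have Bself : ∀ x, B x x = 2 * Q x := fun x => by
    have := QuadraticMap.polar_self Q x
    simpa [hB] using this
  have Qadd : ∀ x y, Q (x + y) = Q x + Q y + B x y := fun x y => by
    simp [hB, QuadraticMap.polar]
  have BL : ∀ x ∈ L, ∀ y ∈ L, B x y = 0 := fun x hx y hy => by
    have := Qadd x y
    rw [hQ x hx, hQ y hy, hQ _ (L.add_mem hx hy)] at this
    simpa using this.symm
  let b : Basis (Fin (r + 1)) K L := (finBasis K L).reindex (finCongr hL)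
  have hy : ∀ j, ∃ y : V, ∀ i, B (b i : V) y = if i = j then 1 else 0 := fun j => by
    obtain ⟨g, hg⟩ := LinearMap.exists_extend (p := L) (b.coord j)
    refine ⟨(LinearMap.BilinForm.toDual B hnd).symm g, fun i => ?_⟩
    rw [Bsymm, LinearMap.BilinForm.apply_toDual_symm_apply]
    have : g (b i : V) = b.coord j (b i) := by rw [← hg]; rfl
    rw [this]
    simp [Finsupp.single_apply]
  choose y hy using hy
  let e : Fin (r + 1) → V := fun i => (b i : V)
  let h : Fin (r + 1) → V := fun j => y j - ∑ k, ((2 : K)⁻¹ * B (y j) (y k)) • e k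
  have eL : ∀ i, e i ∈ L := fun i => (b i).2
  have ee : ∀ i j, B (e i) (e j) = 0 := fun i j => BL _ (eL i) _ (eL j)
  have ey : ∀ i j, B (e i) (y j) = if i = j then 1 else 0 := fun i j => hy j i
  have eh : ∀ i j, B (e i) (h j) = if i = j then 1 else 0 := fun i j => by
    simp [h, ee, ey]
  have hh : ∀ i j, B (h i) (h j) = 0 := fun i j => by
    have h1 : B (h i) (h j) = B (h i) (y j) - ∑ k, ((2 : K)⁻¹ * B (y j) (y k)) * B (h i) (e k) := by
      conv_lhs => rw [show h j = y j - ∑ k, ((2 : K)⁻¹ * B (y j) (y k)) • e k from rfl]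
      simp
    have h2 : ∀ k, B (h i) (e k) = if k = i then 1 else 0 := fun k => by rw [Bsymm, eh]
    have h3 : B (h i) (y j) = B (y i) (y j) - 2⁻¹ * B (y i) (y j) := by
      simp [h, ey]
    rw [h1, h3]
    simp only [h2]
    simp only [mul_ite, mul_one, mul_zero, Finset.sum_ite_eq', Finset.mem_univ, if_true]
    rw [Bsymm (y j) (y i)]
    field_simp
    ring
  have he : ∀ i j, B (h i) (e j) = if i = j then 1 else 0 := fun i j => by
    rw [Bsymm, eh]; simp [eq_comm]
  let s : ℕ → K := fun i => (-1) ^ i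
  let c : Fin (2 * r + 2) → V := fun i => e ⟨i / 2, by omega⟩ + s i • h ⟨i / 2, by omega⟩
  have cc : ∀ i j, B (c i) (c j) = if i = j then 2 * s i else 0 := fun i j => by
    simp only [c, map_add, LinearMap.add_apply, map_smul, LinearMap.smul_apply, smul_eq_mul, ee, hh,
      eh, he, Fin.mk.injEq]
    by_cases hij : i = j
    · subst hij; simp; ring
    · rw [if_neg hij]
      by_cases h2 : (i : ℕ) / 2 = j / 2
      · have hij' : (i : ℕ) ≠ j := fun h => hij (Fin.ext h)
        have : s i + s j = 0 := by
          rcases Nat.even_or_odd (i : ℕ) with hi | hi <;> rcases Nat.even_or_odd (j : ℕ) with hj | hj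
          · exfalso; obtain ⟨a, ha⟩ := hi; obtain ⟨d, hd⟩ := hj; omega
          · simp [s, hi.neg_one_pow, hj.neg_one_pow]
          · simp [s, hi.neg_one_pow, hj.neg_one_pow]
          · exfalso; obtain ⟨a, ha⟩ := hi; obtain ⟨d, hd⟩ := hj; omega
        simp [h2]; exact this
      · simp [h2]
  have s0 : ∀ i, s i ≠ 0 := fun i => pow_ne_zero _ (by simp)
  have hli : LinearIndependent K c := by
    apply LinearMap.linearIndependent_of_isOrthoᵢ (B := B)
    · intro i j hij
      change B (c i) (c j) = 0
      rw [cc, if_neg hij]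
    · intro i
      rw [cc, if_pos rfl]
      exact mul_ne_zero two_ne_zero (s0 i)
  let v := basisOfLinearIndependentOfCardEqFinrank hli (by simp [hV])
  have vc : ∀ i, v i = c i := fun i => by simp [v]
  have hQv : ∀ i, Q (v i) = (-1 : K) ^ (i : ℕ) := fun i => by
    have := Bself (v i)
    rw [vc, cc, if_pos rfl] at this
    rw [vc]
    exact (mul_left_cancel₀ two_ne_zero this).symm
  refine ⟨?_⟩
  have key := QuadraticMap.basisRepr_eq_of_iIsOrtho Q v (by
    intro i j hij
    change QuadraticMap.associated Q (v i) (v j) = 0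
    rw [vc, vc, QuadraticMap.associated_apply]
    have := cc i j
    rw [if_neg hij] at this
    have h2 := Qadd (c i) (c j)
    rw [this] at h2
    rw [h2]; simp)
  have iso := QuadraticMap.isometryEquivBasisRepr Q v
  rw [key] at iso
  simp only [hQv] at iso
  exact iso

/-- The hyperbolic form has a totally isotropic subspace of half dimension. -/
theorem isotropic_of_hyperbolic {K V : Type*} [Field K] [AddCommGroup V] [Module K V]
    (r : ℕ) (Q : QuadraticForm K V)
    (h : QuadraticMap.Equivalent Q (QuadraticMap.weightedSumSquares K
      (fun i : Fin (2 * r + 2) => (-1 : K) ^ (i : ℕ)))) :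
    ∃ L : Submodule K V, finrank K L = r + 1 ∧ ∀ x ∈ L, Q x = 0 := by
  obtain ⟨φ⟩ := h
  let T : (Fin (r + 1) → K) →ₗ[K] (Fin (2 * r + 2) → K) :=
    LinearMap.funLeft K K (fun i : Fin (2 * r + 2) => (⟨i / 2, by omega⟩ : Fin (r + 1)))
  have hT : Function.Injective T := LinearMap.funLeft_injective_of_surjective _ _ _ (fun j =>
    ⟨⟨2 * j, by omega⟩, by ext; simp⟩)
  refine ⟨LinearMap.range (φ.toLinearEquiv.symm.toLinearMap ∘ₗ T), ?_, ?_⟩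
  · rw [LinearMap.finrank_range_of_inj (show Function.Injective (φ.toLinearEquiv.symm.toLinearMap ∘ₗ T) from
      (φ.toLinearEquiv.symm.injective.comp hT :
        Function.Injective (φ.toLinearEquiv.symm ∘ T)))]
    simp
  · rintro _ ⟨x, rfl⟩
    rw [← φ.map_app]
    have : φ ((φ.toLinearEquiv.symm.toLinearMap ∘ₗ T) x) = T x :=
      φ.toLinearEquiv.apply_symm_apply (T x)
    rw [this, QuadraticMap.weightedSumSquares_apply]
    have e : 2 * (r + 1) = 2 * r + 2 := by ring
    let G : ℕ → K := fun i => if h : i / 2 < r + 1 then (-1) ^ i * (x ⟨i / 2, h⟩ * x ⟨i / 2, h⟩) else 0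
    have : ∀ n, ∑ i ∈ Finset.range (2 * n), G i = 0 := fun n => by
      induction n with
      | zero => simp
      | succ n ih =>
        rw [show 2 * (n + 1) = 2 * n + 1 + 1 by ring, Finset.sum_range_succ, Finset.sum_range_succ, ih]
        have h1 : (2 * n + 1) / 2 = n := by omega
        have h2 : (2 * n) / 2 = n := by omega
        simp only [G, h1, h2]
        split_ifs
        · rw [pow_succ, pow_mul]; simp
        · simp
    rw [← this (r + 1), e, ← Fin.sum_univ_eq_sum_range]
    refine Finset.sum_congr rfl fun i _ => ?_
    have hi : (i : ℕ) / 2 < r + 1 := by omega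
    simp only [G, dif_pos hi, T, LinearMap.funLeft_apply, smul_eq_mul]

end AmerAux

namespace AmerAux

open Module Polynomial

section
variable {F : Type*} [Field F] {n : ℕ}

/-- The Gram matrix of the pencil over the polynomial ring. -/
noncomputable def pm (A G : Matrix (Fin n) (Fin n) F) : Matrix (Fin n) (Fin n) F[X] :=
  A.map C + (X : F[X]) • G.map C

/-- The bilinear form of the pencil over the polynomial ring. -/
noncomputable def pb (A G : Matrix (Fin n) (Fin n) F) : LinearMap.BilinForm F[X] (Fin n → F[X]) :=
  Matrix.toBilin' (pm A G)

/-- The bilinear form of the pencil over the rational function field. -/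
noncomputable def kb (A G : Matrix (Fin n) (Fin n) F) :
    LinearMap.BilinForm (RatFunc F) (Fin n → RatFunc F) :=
  Matrix.toBilin' ((pm A G).map (algebraMap F[X] (RatFunc F)))

/-- Constant vectors as polynomial vectors. -/
noncomputable def kap (u : Fin n → F) : Fin n → F[X] := fun i => C (u i)

/-- Polynomial vectors as vectors over the rational function field. -/
noncomputable def iot : (Fin n → F[X]) →ₗ[F[X]] (Fin n → RatFunc F) :=
  LinearMap.compLeft (Algebra.linearMap F[X] (RatFunc F)) (Fin n)

/-- Constant vectors as vectors over the rational function field. -/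
noncomputable def cst : (Fin n → F) →ₗ[F] (Fin n → RatFunc F) :=
  LinearMap.compLeft (Algebra.linearMap F (RatFunc F)) (Fin n)

theorem iot_kap (u : Fin n → F) : iot (kap u) = cst u := by
  ext i
  simp only [iot, kap, cst, LinearMap.compLeft_apply, Function.comp, Algebra.linearMap_apply]
  rw [IsScalarTower.algebraMap_apply F F[X] (RatFunc F)]
  rfl

theorem kb_iot (A G : Matrix (Fin n) (Fin n) F) (x y : Fin n → F[X]) :
    kb A G (iot x) (iot y) = algebraMap F[X] (RatFunc F) (pb A G x y) := by
  simp [kb, pb, Matrix.toBilin'_apply, iot, map_sum]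

theorem pb_symm {A G : Matrix (Fin n) (Fin n) F} (hA : A.IsSymm) (hG : G.IsSymm)
    (x y : Fin n → F[X]) : pb A G x y = pb A G y x := by
  simp only [pb, Matrix.toBilin'_apply]
  rw [Finset.sum_comm]
  refine Finset.sum_congr rfl fun i _ => Finset.sum_congr rfl fun j _ => ?_
  simp only [pm, Matrix.add_apply, Matrix.map_apply, Matrix.smul_apply, hA.apply i j, hG.apply i j]
  ring

theorem kb_symm {A G : Matrix (Fin n) (Fin n) F} (hA : A.IsSymm) (hG : G.IsSymm)
    (x y : Fin n → RatFunc F) : kb A G x y = kb A G y x := by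
  simp only [kb, Matrix.toBilin'_apply]
  rw [Finset.sum_comm]
  refine Finset.sum_congr rfl fun i _ => Finset.sum_congr rfl fun j _ => ?_
  simp only [pm, Matrix.add_apply, Matrix.map_apply, Matrix.smul_apply, hA.apply i j, hG.apply i j]
  ring

theorem pb_kap (A G : Matrix (Fin n) (Fin n) F) (u w : Fin n → F) :
    pb A G (kap u) (kap w) = C (Matrix.toBilin' A u w) + X * C (Matrix.toBilin' G u w) := by
  simp only [pb, pm, kap, Matrix.toBilin'_apply, map_sum, Finset.mul_sum, ← Finset.sum_add_distrib]
  refine Finset.sum_congr rfl fun i _ => Finset.sum_congr rfl fun j _ => ?_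
  simp; ring

theorem degree_pb_lt (A G : Matrix (Fin n) (Fin n) F) {a b : ℕ} {x y : Fin n → F[X]}
    (hx : ∀ i, x i ∈ degreeLT F a) (hy : ∀ i, y i ∈ degreeLT F b) :
    pb A G x y ∈ degreeLT F (a + b) := by
  simp only [pb, Matrix.toBilin'_apply]
  refine Submodule.sum_mem _ fun i _ => Submodule.sum_mem _ fun j _ => ?_
  have hx := mem_degreeLT.1 (hx i)
  have hy := mem_degreeLT.1 (hy j)
  rw [mem_degreeLT]
  by_cases x0 : x i = 0
  · simp [x0]
  by_cases y0 : y j = 0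
  · simp [y0]
  have h1 : (pm A G i j).natDegree ≤ 1 := by
    simp only [pm, Matrix.add_apply, Matrix.map_apply, Matrix.smul_apply, smul_eq_mul]
    compute_degree
  have hx' := (natDegree_lt_iff_degree_lt x0).2 hx
  have hy' := (natDegree_lt_iff_degree_lt y0).2 hy
  have h2 : (x i * pm A G i j * y j).natDegree ≤ (x i).natDegree + 1 + (y j).natDegree :=
    natDegree_mul_le.trans (add_le_add (natDegree_mul_le.trans (add_le_add le_rfl h1)) le_rfl)
  refine lt_of_le_of_lt degree_le_natDegree ?_
  exact_mod_cast (by omega : (x i * pm A G i j * y j).natDegree < a + b)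

theorem kap_deg (u : Fin n → F) (i : Fin n) : kap u i ∈ degreeLT F 1 := by
  rw [mem_degreeLT]; exact lt_of_le_of_lt degree_C_le (by norm_num)

theorem key_g {A G : Matrix (Fin n) (Fin n) F} {d : ℕ} {u w : Fin n → F} {v₁ : Fin n → F[X]}
    (h₁ : ∀ i, v₁ i ∈ degreeLT F d)
    (h : pb A G ((X : F[X]) ^ d • kap u + v₁) (kap w) = 0) : Matrix.toBilin' G u w = 0 := by
  have h2 := degree_pb_lt A G h₁ (kap_deg w)
  have h3 := (mem_degreeLT.1 h2)
  have h4 : (pb A G v₁ (kap w)).coeff (1 + d) = 0 :=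
    coeff_eq_zero_of_degree_lt (by rwa [add_comm 1 d])
  have h5 := congrArg (fun p => p.coeff (1 + d)) h
  simp only [map_add, map_smul, LinearMap.add_apply, LinearMap.smul_apply, pb_kap, coeff_add, h4,
    smul_eq_mul, coeff_zero, add_zero, coeff_X_pow_mul] at h5
  simpa [coeff_C] using h5

theorem key_q [CharZero F] {A G : Matrix (Fin n) (Fin n) F} (hA : A.IsSymm) (hG : G.IsSymm)
    {d : ℕ} {u : Fin n → F} {v v₁ : Fin n → F[X]} (h₁ : ∀ i, v₁ i ∈ degreeLT F d)
    (hv : v = (X : F[X]) ^ d • kap u + v₁) (h : pb A G v v = 0) :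
    Matrix.toBilin' G u u = 0 ∧
      2 * pb A G (kap u) v - X ^ d * C (Matrix.toBilin' A u u) ∈ degreeLT F d := by
  have e : pb A G v v = X ^ d * (2 * pb A G (kap u) v - X ^ d * pb A G (kap u) (kap u))
      + pb A G v₁ v₁ := by
    simp only [hv, map_add, map_smul, LinearMap.add_apply, LinearMap.smul_apply, smul_eq_mul,
      pb_symm hA hG v₁ (kap u)]
    ring
  have h2 := mem_degreeLT.1 (degree_pb_lt A G h₁ h₁)
  have h3 : 2 * pb A G (kap u) v - X ^ d * pb A G (kap u) (kap u) ∈ degreeLT F d := by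
    rw [mem_degreeLT, degree_lt_iff_coeff_zero]
    intro m hm
    have := congrArg (fun p => p.coeff (m + d)) (e.symm.trans h)
    simp only [coeff_add, coeff_X_pow_mul, coeff_zero] at this
    rwa [coeff_eq_zero_of_degree_lt (p := pb A G v₁ v₁)
      (h2.trans_le (by exact_mod_cast by omega)), add_zero] at this
  have h4 := mem_degreeLT.1 (degree_pb_lt A G (kap_deg u) h₁)
  have hg : Matrix.toBilin' G u u = 0 := by
    have h5 : (2 * pb A G (kap u) v - X ^ d * pb A G (kap u) (kap u)).coeff (1 + d) = 0 :=
      coeff_eq_zero_of_degree_lt ((mem_degreeLT.1 h3).trans_le (by exact_mod_cast by omega))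
    have h6 : 2 * pb A G (kap u) v - X ^ d * pb A G (kap u) (kap u) =
        X ^ d * pb A G (kap u) (kap u) + C 2 * pb A G (kap u) v₁ := by
      simp only [hv, map_add, map_smul, smul_eq_mul, map_ofNat]
      ring
    rw [h6, coeff_add, coeff_C_mul, coeff_eq_zero_of_degree_lt (p := pb A G (kap u) v₁)
      (n := 1 + d) h4, coeff_X_pow_mul, pb_kap] at h5
    simpa [coeff_C] using h5
  refine ⟨hg, ?_⟩
  simpa [pb_kap, hg] using h3

theorem kb_cst (A G : Matrix (Fin n) (Fin n) F) (u w : Fin n → F) :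
    kb A G (cst u) (cst w) = algebraMap F[X] (RatFunc F)
      (C (Matrix.toBilin' A u w) + X * C (Matrix.toBilin' G u w)) := by
  rw [← iot_kap, ← iot_kap, kb_iot, pb_kap]

theorem kb_cst' {A G : Matrix (Fin n) (Fin n) F} {u w : Fin n → F}
    (h : Matrix.toBilin' G u w = 0) :
    kb A G (cst u) (cst w) = algebraMap F (RatFunc F) (Matrix.toBilin' A u w) := by
  rw [kb_cst, h, IsScalarTower.algebraMap_apply F F[X] (RatFunc F)]
  simp

theorem kb_cst_zero {A G : Matrix (Fin n) (Fin n) F} {u w : Fin n → F}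
    (h : kb A G (cst u) (cst w) = 0) :
    Matrix.toBilin' A u w = 0 ∧ Matrix.toBilin' G u w = 0 := by
  rw [kb_cst, map_eq_zero_iff _ (IsFractionRing.injective F[X] (RatFunc F))] at h
  have h0 := congrArg (fun p => p.coeff 0) h
  have h1 := congrArg (fun p => p.coeff 1) h
  simp [coeff_C] at h0 h1
  exact ⟨h0, h1⟩

end

theorem finrank_sup_singleton {K V : Type*} [Field K] [AddCommGroup V] [Module K V]
    [FiniteDimensional K V] {S : Submodule K V} {u : V} (hu : u ∉ S) :
    finrank K S + 1 ≤ finrank K ↥(S ⊔ K ∙ u) := by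
  apply Submodule.finrank_lt_finrank_of_lt
  refine lt_of_le_of_ne le_sup_left fun h => hu ?_
  rw [h]
  exact Submodule.mem_sup_right (Submodule.mem_span_singleton_self u)

theorem finrank_ker_sup {K V : Type*} [Field K] [AddCommGroup V] [Module K V]
    [FiniteDimensional K V] (S : Submodule K V) (φ : V →ₗ[K] K) {u : V} (hu : u ∉ S) :
    finrank K S ≤ finrank K ↥((S ⊓ LinearMap.ker φ) ⊔ K ∙ u) := by
  have h1 := finrank_sup_singleton (S := S ⊓ LinearMap.ker φ) (u := u) (fun h => hu h.1)
  have h2 := LinearMap.finrank_range_add_finrank_ker (φ.domRestrict S)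
  have h3 : finrank K (LinearMap.range (φ.domRestrict S)) ≤ 1 :=
    (Submodule.finrank_le _).trans (by simp)
  have h4 : finrank K (LinearMap.ker (φ.domRestrict S)) =
      finrank K ↥(S ⊓ LinearMap.ker φ) := by
    have : S ⊓ LinearMap.ker φ = (LinearMap.ker (φ.domRestrict S)).map S.subtype := by
      ext x; simp [and_comm]
    rw [this, Submodule.finrank_map_subtype_eq]
  omega

end AmerAux

namespace AmerAux

open Module Polynomial

section
variable {F : Type*} [Field F] {n : ℕ}

/-- A totally isotropic subspace `L` of dimension at least `m` together with a space `U` of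
constant vectors contained in it. -/
structure Valid (m : ℕ) (A G : Matrix (Fin n) (Fin n) F) (U : Submodule F (Fin n → F))
    (L : Submodule (RatFunc F) (Fin n → RatFunc F)) : Prop where
  le : ∀ w ∈ U, cst w ∈ L
  iso : ∀ x ∈ L, ∀ y ∈ L, kb A G x y = 0
  dim : m ≤ finrank (RatFunc F) L

/-- There is a common totally isotropic subspace over `F` of dimension at least `m`. -/
def Concl (m : ℕ) (A G : Matrix (Fin n) (Fin n) F) : Prop :=
  ∃ W : Submodule F (Fin n → F), m ≤ finrank F W ∧
    ∀ x ∈ W, ∀ y ∈ W, Matrix.toBilin' A x y = 0 ∧ Matrix.toBilin' G x y = 0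

theorem inner_ind [CharZero F] {m : ℕ} {A G : Matrix (Fin n) (Fin n) F}
    (hA : A.IsSymm) (hG : G.IsSymm) (c : ℕ)
    (outer : ∀ U L, Valid m A G U L → c < finrank F U → Concl m A G) :
    ∀ (d : ℕ) (U : Submodule F (Fin n → F)) (L : Submodule (RatFunc F) (Fin n → RatFunc F)),
      Valid m A G U L → c ≤ finrank F U → ∀ v : Fin n → F[X],
      (∀ i, v i ∈ degreeLT F d) → iot v ∈ L →
      iot v ∉ Submodule.span (RatFunc F) (cst '' (U : Set (Fin n → F))) → Concl m A G := by
  intro d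
  induction d with
  | zero =>
    intro U L _ _ v hv _ hvU
    exfalso
    apply hvU
    have : v = 0 := by
      ext1 i
      have := mem_degreeLT.1 (hv i)
      simpa using this
    rw [this, map_zero]
    exact Submodule.zero_mem _
  | succ d ih =>
    intro U L hval hc v hvd hvL hvU
    let S := Submodule.span (RatFunc F) (cst '' (U : Set (Fin n → F)))
    have cstS : ∀ w ∈ U, cst w ∈ S := fun w hw => Submodule.subset_span ⟨w, hw, rfl⟩
    have hSL : S ≤ L := by
      rw [Submodule.span_le]
      rintro _ ⟨w, hw, rfl⟩
      exact hval.le w hw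
    let u : Fin n → F := fun i => (v i).coeff d
    let v₁ : Fin n → F[X] := v - (X : F[X]) ^ d • kap u
    have hv : v = (X : F[X]) ^ d • kap u + v₁ := by simp [v₁]
    have h₁ : ∀ i, v₁ i ∈ degreeLT F d := by
      intro i
      rw [mem_degreeLT, degree_lt_iff_coeff_zero]
      intro k hk
      have h2 : k ≠ d → (v i).coeff k = 0 := fun hkd =>
        coeff_eq_zero_of_degree_lt ((mem_degreeLT.1 (hvd i)).trans_le (by exact_mod_cast by omega))
      simp only [v₁, kap, u, Pi.sub_apply, Pi.smul_apply, smul_eq_mul, coeff_sub,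
        X_pow_mul_C, coeff_C_mul, coeff_X_pow]
      by_cases hkd : k = d
      · simp [hkd]
      · simp [hkd, h2 hkd]
    have iotv : iot v = algebraMap F[X] (RatFunc F) (X ^ d) • cst u + iot v₁ := by
      conv_lhs => rw [hv]
      rw [map_add, map_smul, iot_kap, algebraMap_smul]
    have hvv : pb A G v v = 0 := by
      have := hval.iso _ hvL _ hvL
      rwa [kb_iot, map_eq_zero_iff _ (IsFractionRing.injective F[X] (RatFunc F))] at this
    obtain ⟨hgu, hdeg⟩ := key_q hA hG h₁ hv hvv
    have hgw : ∀ w ∈ U, Matrix.toBilin' G u w = 0 := by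
      intro w hw
      have := hval.iso _ hvL _ (hval.le w hw)
      rw [← iot_kap, kb_iot, map_eq_zero_iff _ (IsFractionRing.injective F[X] (RatFunc F)), hv]
        at this
      exact key_g h₁ this
    by_cases huU : u ∈ U
    · refine ih U L hval hc v₁ h₁ ?_ ?_
      · have : iot v₁ = iot v - algebraMap F[X] (RatFunc F) (X ^ d) • cst u := by simp [iotv]
        rw [this]
        exact L.sub_mem hvL (L.smul_mem _ (hval.le u huU))
      · intro h
        apply hvU
        rw [iotv]
        exact Submodule.add_mem _ (Submodule.smul_mem _ _ (cstS u huU)) h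
    by_cases huL : cst u ∈ L
    · refine outer (U ⊔ F ∙ u) L ⟨?_, hval.iso, hval.dim⟩ ?_
      · intro w hw
        obtain ⟨y, hy, z, hz, rfl⟩ := Submodule.mem_sup.1 hw
        obtain ⟨a, rfl⟩ := Submodule.mem_span_singleton.1 hz
        rw [map_add, map_smul, ← algebraMap_smul (RatFunc F) a]
        exact L.add_mem (hval.le y hy) (L.smul_mem _ huL)
      · have := finrank_sup_singleton huU
        omega
    by_cases hfu : Matrix.toBilin' A u u = 0
    · -- `u` is a common zero
      have quu : kb A G (cst u) (cst u) = 0 := by rw [kb_cst' hgu, hfu, map_zero]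
      let φK := kb A G (cst u)
      let φF := Matrix.toBilin' A u
      let L' := (L ⊓ LinearMap.ker φK) ⊔ (RatFunc F) ∙ (cst u)
      have huL' : cst u ∈ L' := Submodule.mem_sup_right (Submodule.mem_span_singleton_self _)
      have hL' : ∀ x ∈ L, kb A G (cst u) x = 0 → x ∈ L' := fun x hx h =>
        Submodule.mem_sup_left ⟨hx, h⟩
      have hval' : ∀ U' : Submodule F (Fin n → F), U' ≤ (U ⊓ LinearMap.ker φF) ⊔ F ∙ u →
          Valid m A G U' L' := by
        intro U' hU'
        refine ⟨?_, ?_, ?_⟩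
        · intro w hw
          obtain ⟨y, hy, z, hz, rfl⟩ := Submodule.mem_sup.1 (hU' hw)
          obtain ⟨a, rfl⟩ := Submodule.mem_span_singleton.1 hz
          rw [map_add, map_smul, ← algebraMap_smul (RatFunc F) a]
          refine L'.add_mem (hL' _ (hval.le y hy.1) ?_) (L'.smul_mem _ huL')
          have : Matrix.toBilin' A u y = 0 := hy.2
          rw [kb_cst' (hgw y hy.1), this, map_zero]
        · intro x hx y hy
          obtain ⟨x₁, hx₁, z, hz, rfl⟩ := Submodule.mem_sup.1 hx
          obtain ⟨a, rfl⟩ := Submodule.mem_span_singleton.1 hz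
          obtain ⟨y₁, hy₁, z, hz, rfl⟩ := Submodule.mem_sup.1 hy
          obtain ⟨b, rfl⟩ := Submodule.mem_span_singleton.1 hz
          have e1 : kb A G (cst u) x₁ = 0 := hx₁.2
          have e2 : kb A G (cst u) y₁ = 0 := hy₁.2
          have e3 := hval.iso x₁ hx₁.1 y₁ hy₁.1
          simp [e1, e2, e3, quu, kb_symm hA hG x₁ (cst u)]
        · exact hval.dim.trans (finrank_ker_sup L φK huL)
      by_cases hperp : ∀ w ∈ U, Matrix.toBilin' A u w = 0
      · refine outer (U ⊔ F ∙ u) L' (hval' _ ?_) ?_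
        · exact sup_le_sup_right (le_inf le_rfl hperp) _
        · have := finrank_sup_singleton huU
          omega
      · push Not at hperp
        obtain ⟨w, hw, hβ⟩ := hperp
        set β := Matrix.toBilin' A u w with hβdef
        have hβK : kb A G (cst u) (cst w) = algebraMap F (RatFunc F) β := kb_cst' (hgw w hw)
        -- the corrected vector
        let p : F[X] := C β⁻¹ * pb A G (kap u) v
        let v₂ : Fin n → F[X] := v₁ - p • kap w
        have hp : p ∈ degreeLT F d := by
          have h2 : pb A G (kap u) v = C (2⁻¹ : F) * (2 * pb A G (kap u) v) := by
            rw [show (2 : F[X]) = C (2 : F) from (map_ofNat C 2).symm, ← mul_assoc, ← C_mul]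
            simp
          simp only [p]
          rw [h2, ← mul_assoc, ← C_mul, ← smul_eq_C_mul]
          refine Submodule.smul_mem _ _ ?_
          simpa [hfu] using hdeg
        have hpd : ∀ i, v₂ i ∈ degreeLT F d := by
          intro i
          refine Submodule.sub_mem _ (h₁ i) ?_
          simp only [Pi.smul_apply, kap, smul_eq_mul]
          rw [mul_comm, ← smul_eq_C_mul]
          exact Submodule.smul_mem _ _ hp
        have hv₂ : iot v₂ = (iot v - algebraMap F[X] (RatFunc F) p • cst w)
            - algebraMap F[X] (RatFunc F) (X ^ d) • cst u := by
          simp only [v₂]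
          rw [map_sub, map_smul, iot_kap, iotv, algebraMap_smul (RatFunc F) p (cst w)]
          abel
        refine ih ((U ⊓ LinearMap.ker φF) ⊔ F ∙ u) L' (hval' _ le_rfl)
          (hc.trans (finrank_ker_sup U φF huU)) v₂ hpd ?_ ?_
        · rw [hv₂]
          refine L'.sub_mem (hL' _ (L.sub_mem hvL (L.smul_mem _ (hval.le w hw))) ?_)
            (L'.smul_mem _ huL')
          rw [map_sub, map_smul, hβK, ← iot_kap, kb_iot, smul_eq_mul,
            IsScalarTower.algebraMap_apply F F[X] (RatFunc F), ← map_mul, ← map_sub]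
          have : pb A G (kap u) v - p * algebraMap F F[X] β = 0 := by
            simp only [p, Polynomial.algebraMap_eq]
            rw [mul_right_comm, ← C_mul, inv_mul_cancel₀ hβ]
            simp
          rw [this, map_zero]
        · intro hmem
          have hsub : Submodule.span (RatFunc F)
              (cst '' (((U ⊓ LinearMap.ker φF) ⊔ F ∙ u : Submodule F (Fin n → F)) :
                Set (Fin n → F))) ≤ S ⊔ (RatFunc F) ∙ (cst u) := by
            rw [Submodule.span_le]
            rintro _ ⟨x, hx, rfl⟩
            obtain ⟨y, hy, z, hz, rfl⟩ := Submodule.mem_sup.1 hx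
            obtain ⟨a, rfl⟩ := Submodule.mem_span_singleton.1 hz
            rw [map_add, map_smul, ← algebraMap_smul (RatFunc F) a]
            exact Submodule.add_mem_sup (cstS y hy.1)
              (Submodule.smul_mem _ _ (Submodule.mem_span_singleton_self _))
          obtain ⟨y, hy, z, hz, hyz⟩ := Submodule.mem_sup.1 (hsub hmem)
          obtain ⟨a, rfl⟩ := Submodule.mem_span_singleton.1 hz
          rw [hv₂] at hyz
          set s := algebraMap F[X] (RatFunc F) (X ^ d) with hs
          set t := algebraMap F[X] (RatFunc F) p with ht
          have e1 : (a + s) • cst u = iot v - t • cst w - y := by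
            rw [add_smul, ← sub_eq_zero]
            have := sub_eq_zero.2 hyz
            rw [← this]; abel
          have h0 : a + s ≠ 0 := by
            intro h0
            rw [h0, zero_smul] at e1
            apply hvU
            have : iot v = t • cst w + y := by
              rw [← sub_eq_zero, e1]; abel
            rw [this]
            exact S.add_mem (S.smul_mem _ (cstS w hw)) hy
          apply huL
          have : cst u = (a + s)⁻¹ • (iot v - t • cst w - y) := by
            rw [← e1, smul_smul, inv_mul_cancel₀ h0, one_smul]
          rw [this]
          exact L.smul_mem _ (L.sub_mem (L.sub_mem hvL (L.smul_mem _ (hval.le w hw))) (hSL hy))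
    · -- reflect in `u`
      set α := Matrix.toBilin' A u u with hα
      let φF : Module.Dual F (Fin n → F) := (2 * α⁻¹) • Matrix.toBilin' A u
      let φK : Module.Dual (RatFunc F) (Fin n → RatFunc F) :=
        (algebraMap F (RatFunc F) (2 * α⁻¹)) • kb A G (cst u)
      have hφF : φF u = 2 := by
        simp only [φF, LinearMap.smul_apply, smul_eq_mul, ← hα]
        field_simp
      have hφw : ∀ w, Matrix.toBilin' G u w = 0 → φK (cst w) = algebraMap F (RatFunc F) (φF w) := by
        intro w hw
        simp only [φF, φK, LinearMap.smul_apply, smul_eq_mul]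
        rw [kb_cst' hw, ← map_mul]
      have hφK : φK (cst u) = 2 := by rw [hφw u hgu, hφF]; exact map_ofNat _ 2
      let τF := Module.reflection hφF
      let τK := Module.reflection hφK
      have hτ : ∀ w ∈ U, cst (τF w) = τK (cst w) := by
        intro w hw
        simp only [τF, τK, Module.reflection_apply]
        rw [hφw w (hgw w hw), map_sub, map_smul, algebraMap_smul]
      have hiso : ∀ x y, kb A G (τK x) (τK y) = kb A G x y := by
        intro x y
        have hq : kb A G (cst u) (cst u) = algebraMap F (RatFunc F) α := kb_cst' hgu
        have hα' : algebraMap F (RatFunc F) α ≠ 0 := by simpa using hfu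
        simp only [τK, Module.reflection_apply, φK, map_sub, map_smul, LinearMap.sub_apply,
          LinearMap.smul_apply, smul_eq_mul, hq, kb_symm hA hG x (cst u), map_mul, map_inv₀,
          map_ofNat]
        field_simp
        ring
      let p : F[X] := C (α⁻¹) * (2 * pb A G (kap u) v - X ^ d * C α)
      let v₂ : Fin n → F[X] := v₁ - p • kap u
      have hp : p ∈ degreeLT F d := by
        simp only [p]
        rw [← smul_eq_C_mul]
        exact Submodule.smul_mem _ _ hdeg
      have hpd : ∀ i, v₂ i ∈ degreeLT F d := by
        intro i
        refine Submodule.sub_mem _ (h₁ i) ?_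
        simp only [Pi.smul_apply, kap, smul_eq_mul]
        rw [mul_comm, ← smul_eq_C_mul]
        exact Submodule.smul_mem _ _ hp
      have hv₂ : iot v₂ = τK (iot v) := by
        have e1 : φK (iot v) = algebraMap F[X] (RatFunc F) (p + X ^ d) := by
          simp only [φK, LinearMap.smul_apply, smul_eq_mul]
          rw [← iot_kap, kb_iot, IsScalarTower.algebraMap_apply F F[X] (RatFunc F), ← map_mul]
          congr 1
          simp only [p, Polynomial.algebraMap_eq, C_mul]
          have : C α⁻¹ * C α = (1 : F[X]) := by rw [← C_mul, inv_mul_cancel₀ hfu, C_1]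
          rw [show (C (2 : F) : F[X]) = 2 from map_ofNat C 2]
          linear_combination (X ^ d) * this
        simp only [τK, Module.reflection_apply]
        rw [e1]
        simp only [v₂]
        rw [map_sub, map_smul, iot_kap, map_add, iotv, add_smul, algebraMap_smul, algebraMap_smul]
        abel
      refine ih (U.map τF.toLinearMap) (L.map τK.toLinearMap) ⟨?_, ?_, ?_⟩ ?_ v₂ hpd ?_ ?_
      · rintro _ ⟨w, hw, rfl⟩
        exact ⟨cst w, hval.le w hw, (hτ w hw).symm⟩
      · rintro _ ⟨x, hx, rfl⟩ _ ⟨y, hy, rfl⟩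
        exact (hiso x y).trans (hval.iso x hx y hy)
      · have := LinearEquiv.finrank_map_eq τK L
        exact hval.dim.trans this.ge
      · have := LinearEquiv.finrank_map_eq τF U
        exact hc.trans this.ge
      · rw [hv₂]
        exact ⟨iot v, hvL, rfl⟩
      · rw [hv₂]
        intro hmem
        have hsub : Submodule.span (RatFunc F)
            (cst '' ((U.map τF.toLinearMap : Submodule F (Fin n → F)) : Set (Fin n → F))) ≤
              S.map τK.toLinearMap := by
          rw [Submodule.span_le]
          rintro _ ⟨_, ⟨w, hw, rfl⟩, rfl⟩
          exact ⟨cst w, cstS w hw, (hτ w hw).symm⟩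
        obtain ⟨x, hx, hxv⟩ := hsub hmem
        have : x = iot v := τK.injective hxv
        exact hvU (this ▸ hx)

theorem outer_ind [CharZero F] {m : ℕ} {A G : Matrix (Fin n) (Fin n) F}
    (hA : A.IsSymm) (hG : G.IsSymm) :
    ∀ (N : ℕ) (U : Submodule F (Fin n → F)) (L : Submodule (RatFunc F) (Fin n → RatFunc F)),
      Valid m A G U L → n < finrank F U + N → Concl m A G := by
  intro N
  induction N with
  | zero =>
    intro U L _ h
    have := Submodule.finrank_le U
    simp at this
    omega
  | succ N ih =>
    intro U L hval hN
    let S := Submodule.span (RatFunc F) (cst '' (U : Set (Fin n → F)))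
    by_cases hLS : L ≤ S
    · refine ⟨U, ?_, ?_⟩
      · refine hval.dim.trans ((Submodule.finrank_mono hLS).trans ?_)
        let b := finBasis F U
        have hS : S ≤ Submodule.span (RatFunc F) (Set.range fun i => cst (b i : Fin n → F)) := by
          rw [Submodule.span_le]
          rintro _ ⟨w, hw, rfl⟩
          have := b.sum_repr ⟨w, hw⟩
          have h2 := congrArg (fun x : U => cst (x : Fin n → F)) this
          simp only [Submodule.coe_sum, Submodule.coe_smul, map_sum, map_smul] at h2
          rw [← h2]
          refine Submodule.sum_mem _ fun i _ => ?_
          rw [← algebraMap_smul (RatFunc F) (b.repr ⟨w, hw⟩ i)]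
          exact Submodule.smul_mem _ _ (Submodule.subset_span ⟨i, rfl⟩)
        refine (Submodule.finrank_mono hS).trans ?_
        refine (finrank_range_le_card _).trans ?_
        simp
      · intro x hx y hy
        exact kb_cst_zero (hval.iso _ (hval.le x hx) _ (hval.le y hy))
    · obtain ⟨x, hxL, hxS⟩ := Set.not_subset.1 hLS
      obtain ⟨q, hq⟩ := IsLocalization.exist_integer_multiples_of_finite (nonZeroDivisors F[X]) x
      choose v hv using hq
      have hiv : iot v = algebraMap F[X] (RatFunc F) q • x := by
        ext1 i
        rw [algebraMap_smul]
        exact hv i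
      have hq0 : algebraMap F[X] (RatFunc F) q ≠ 0 :=
        IsFractionRing.to_map_ne_zero_of_mem_nonZeroDivisors q.2
      refine inner_ind hA hG (finrank F U) (fun U' L' hv' h => ih U' L' hv' (by omega))
        ((Finset.univ.sup fun i => (v i).natDegree) + 1) U L hval le_rfl v ?_ ?_ ?_
      · intro i
        rw [mem_degreeLT]
        refine lt_of_le_of_lt degree_le_natDegree ?_
        have := Finset.le_sup (f := fun i => (v i).natDegree) (Finset.mem_univ i)
        exact_mod_cast Nat.lt_succ_of_le this
      · rw [hiv]; exact L.smul_mem _ hxL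
      · rw [hiv]
        intro h
        exact hxS ((Submodule.smul_mem_iff _ hq0).1 h)

/-- Amer's theorem. -/
theorem amer [CharZero F] {A G : Matrix (Fin n) (Fin n) F} (hA : A.IsSymm) (hG : G.IsSymm)
    (L : Submodule (RatFunc F) (Fin n → RatFunc F)) (hL : ∀ x ∈ L, ∀ y ∈ L, kb A G x y = 0) :
    Concl (finrank (RatFunc F) L) A G :=
  outer_ind hA hG (n + 1) ⊥ L ⟨by simp, hL, le_rfl⟩ (by omega)

end

end AmerAux

namespace AmerAux

open Module Polynomial

section
variable {F : Type*} [Field F] [CharZero F] {n : ℕ}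

/-- The Gram matrix of a quadratic form. -/
noncomputable def gram (f : QuadraticForm F (Fin n → F)) : Matrix (Fin n) (Fin n) F :=
  QuadraticForm.toMatrix' f

theorem gram_symm (f : QuadraticForm F (Fin n → F)) : (gram f).IsSymm :=
  QuadraticForm.isSymm_toMatrix' f

theorem gram_apply (f : QuadraticForm F (Fin n → F)) (x y : Fin n → F) :
    Matrix.toBilin' (gram f) x y = QuadraticMap.associated f x y := by
  have : Matrix.toBilin' (gram f) = QuadraticMap.associated f := by
    exact Matrix.toLinearMap₂'_toMatrix' (R := F) (QuadraticMap.associated f)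
  rw [this]

theorem gram_self (f : QuadraticForm F (Fin n → F)) (x : Fin n → F) :
    Matrix.toBilin' (gram f) x x = f x := by
  rw [gram_apply, QuadraticMap.associated_eq_self_apply]

/-- The pencil over the rational function field. -/
noncomputable def pencil (f g : QuadraticForm F (Fin n → F)) :
    QuadraticForm (RatFunc F) (Fin n → RatFunc F) :=
  f.mapBase (algebraMap F (RatFunc F)) +
        (RatFunc.X : RatFunc F) • g.mapBase (algebraMap F (RatFunc F))

theorem mapBase_apply (f : QuadraticForm F (Fin n → F)) (x : Fin n → RatFunc F) :
    f.mapBase (algebraMap F (RatFunc F)) x =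
      Matrix.toBilin' ((gram f).map (algebraMap F (RatFunc F))) x x := rfl

theorem pencil_apply (f g : QuadraticForm F (Fin n → F)) (x : Fin n → RatFunc F) :
    pencil f g x = kb (gram f) (gram g) x x := by
  have e : (pm (gram f) (gram g)).map (algebraMap F[X] (RatFunc F)) =
      (gram f).map (algebraMap F (RatFunc F)) +
        (RatFunc.X : RatFunc F) • (gram g).map (algebraMap F (RatFunc F)) := by
    ext i j
    simp only [pm, Matrix.map_apply, Matrix.add_apply, Matrix.smul_apply, smul_eq_mul, map_add,
      map_mul, RatFunc.algebraMap_X, IsScalarTower.algebraMap_apply F F[X] (RatFunc F),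
      Polynomial.algebraMap_eq]
  rw [kb, e, map_add, map_smul]
  simp only [pencil, QuadraticMap.add_apply, QuadraticMap.smul_apply, mapBase_apply,
    LinearMap.add_apply, LinearMap.smul_apply]

theorem kb_zero_of_pencil (f g : QuadraticForm F (Fin n → F))
    (L : Submodule (RatFunc F) (Fin n → RatFunc F)) (hL : ∀ x ∈ L, pencil f g x = 0) :
    ∀ x ∈ L, ∀ y ∈ L, kb (gram f) (gram g) x y = 0 := by
  intro x hx y hy
  have h := hL _ (L.add_mem hx hy)
  have h1 := hL x hx
  have h2 := hL y hy
  rw [pencil_apply] at h h1 h2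
  simp only [map_add, LinearMap.add_apply, h1, h2,
    kb_symm (gram_symm f) (gram_symm g) y x, zero_add, add_zero] at h
  have h3 : (2 : RatFunc F) * kb (gram f) (gram g) x y = 0 := by rw [two_mul]; exact h
  exact (mul_eq_zero.1 h3).resolve_left two_ne_zero

theorem assoc_zero (f : QuadraticForm F (Fin n → F)) (W : Submodule F (Fin n → F))
    (hW : ∀ x ∈ W, f x = 0) : ∀ x ∈ W, ∀ y ∈ W, Matrix.toBilin' (gram f) x y = 0 := by
  intro x hx y hy
  rw [gram_apply, QuadraticMap.associated_apply, hW _ (W.add_mem hx hy), hW x hx, hW y hy]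
  simp

theorem finrank_span_cst (W : Submodule F (Fin n → F)) :
    finrank (RatFunc F) (Submodule.span (RatFunc F) (cst '' (W : Set (Fin n → F)))) =
      finrank F W := by
  let b := finBasis F W
  have hS : Submodule.span (RatFunc F) (cst '' (W : Set (Fin n → F))) =
      Submodule.span (RatFunc F) (Set.range fun i => cst (b i : Fin n → F)) := by
    apply le_antisymm
    · rw [Submodule.span_le]
      rintro _ ⟨w, hw, rfl⟩
      have := b.sum_repr ⟨w, hw⟩
      have h2 := congrArg (fun x : W => cst (x : Fin n → F)) this
      simp only [Submodule.coe_sum, Submodule.coe_smul, map_sum, map_smul] at h2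
      rw [← h2]
      refine Submodule.sum_mem _ fun i _ => ?_
      rw [← algebraMap_smul (RatFunc F) (b.repr ⟨w, hw⟩ i)]
      exact Submodule.smul_mem _ _ (Submodule.subset_span ⟨i, rfl⟩)
    · apply Submodule.span_mono
      rintro _ ⟨i, rfl⟩
      exact ⟨b i, (b i).2, rfl⟩
  rw [hS]
  have hli : LinearIndependent F (fun i => (b i : Fin n → F)) :=
    b.linearIndependent.map' W.subtype W.ker_subtype
  have hli2 : LinearIndependent (RatFunc F) (fun i => cst (b i : Fin n → F)) := by
    have h := (linearIndependent_algebraMap_comp_iff (R := F) (S := RatFunc F)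
      (v := fun i => (b i : Fin n → F))).2 hli
    have e : (fun i => cst (b i : Fin n → F)) =
        fun i => algebraMap F (RatFunc F) ∘ (b i : Fin n → F) := by
      funext i j
      simp only [cst, LinearMap.compLeft_apply, Function.comp, Algebra.linearMap_apply]
    rw [e]
    exact h
  rw [finrank_span_eq_card hli2]
  simp

end

end AmerAux

/-- Let `F` be a field of characteristic `0`, and let `f`, `g` be quadratic forms on
`F^{2r+2}` whose pencil `f + t•g` over `F(t)` is nondegenerate. Then `f` and `g` vanish
identically on a common `(r+1)`-dimensional linear subspace of `F^{2r+2}` iff `f + t•g`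
is equivalent over `F(t)` to the orthogonal sum of `r+1` hyperbolic planes `⟨1, -1⟩`,
i.e. iff `f + t•g` is hyperbolic over `F(t)`. -/
theorem vanishing_subspace_iff_pencil_hyperbolic
    (F : Type*) [Field F] [CharZero F] (r : ℕ)
    (f g : QuadraticForm F (Fin (2 * r + 2) → F))
    (hnd : LinearMap.BilinForm.Nondegenerate
      (f.mapBase (algebraMap F (RatFunc F)) +
        (RatFunc.X : RatFunc F) • g.mapBase (algebraMap F (RatFunc F))).polarBilin) :
    (∃ W : Submodule F (Fin (2 * r + 2) → F),
        Module.finrank F ↥W = r + 1 ∧ ∀ x ∈ W, f x = 0 ∧ g x = 0) ↔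
      QuadraticMap.Equivalent
        (f.mapBase (algebraMap F (RatFunc F)) +
          (RatFunc.X : RatFunc F) • g.mapBase (algebraMap F (RatFunc F)))
        (QuadraticMap.weightedSumSquares (RatFunc F)
          (fun i : Fin (2 * r + 2) => (-1 : RatFunc F) ^ (i : ℕ))) := by
  classical
  constructor
  · rintro ⟨W, hW, hfg⟩
    refine AmerAux.hyperbolic_of_isotropic r (by simp) _ hnd
      (Submodule.span (RatFunc F) (AmerAux.cst '' (W : Set _))) ?_ ?_
    · rw [AmerAux.finrank_span_cst, hW]
    · intro x hx
      refine (AmerAux.pencil_apply f g x).trans ?_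
      have h1 : ∀ u ∈ W, ∀ w ∈ W,
          AmerAux.kb (AmerAux.gram f) (AmerAux.gram g) (AmerAux.cst u) (AmerAux.cst w) = 0 := by
        intro u hu w hw
        rw [AmerAux.kb_cst, AmerAux.assoc_zero f W (fun x hx => (hfg x hx).1) u hu w hw,
          AmerAux.assoc_zero g W (fun x hx => (hfg x hx).2) u hu w hw]
        simp
      have h2 : ∀ u ∈ W, AmerAux.kb (AmerAux.gram f) (AmerAux.gram g) (AmerAux.cst u) x = 0 := by
        intro u hu
        have : Submodule.span (RatFunc F) (AmerAux.cst '' (W : Set _)) ≤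
            LinearMap.ker (AmerAux.kb (AmerAux.gram f) (AmerAux.gram g) (AmerAux.cst u)) := by
          rw [Submodule.span_le]
          rintro _ ⟨w, hw, rfl⟩
          exact h1 u hu w hw
        exact this hx
      have : Submodule.span (RatFunc F) (AmerAux.cst '' (W : Set _)) ≤
          LinearMap.ker ((AmerAux.kb (AmerAux.gram f) (AmerAux.gram g)).flip x) := by
        rw [Submodule.span_le]
        rintro _ ⟨w, hw, rfl⟩
        exact h2 w hw
      exact this hx
  · intro h
    obtain ⟨L, hL, hQ⟩ := AmerAux.isotropic_of_hyperbolic r _ h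
    obtain ⟨W, hW, hiso⟩ := AmerAux.amer (AmerAux.gram_symm f) (AmerAux.gram_symm g) L
      (AmerAux.kb_zero_of_pencil f g L hQ)
    rw [hL] at hW
    obtain ⟨e, he⟩ := exists_linearIndependent_of_le_finrank hW
    have he' : LinearIndependent F (fun i => (e i : Fin (2 * r + 2) → F)) :=
      he.map' W.subtype W.ker_subtype
    refine ⟨Submodule.span F (Set.range fun i => (e i : Fin (2 * r + 2) → F)), ?_, ?_⟩
    · rw [finrank_span_eq_card he']
      simp
    · intro x hx
      have hxW : x ∈ W := by
        refine (Submodule.span_le.2 ?_ : _ ≤ W) hx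
        rintro _ ⟨i, rfl⟩
        exact (e i).2
      have := hiso x hxW x hxW
      rwa [AmerAux.gram_self, AmerAux.gram_self] at this
end
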